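/- arXiv:2403.05708 — 3 statements merged into one kernel-verified Lean document; each statement's English description precedes it below -/
import Mathlib

section
/- Let τ > 0, ε ∈ (0, π), and let m ≤ q, n ≤ p be nonnegative integers with N := 2(m+n)−p−q ≠ 0, a ∈ ℂ^p, b ∈ ℂ^q. Then there exist R, C > 0 such that for every s ∈ S⁺_ε ∪ S⁻_ε with |s| ≥ R, one has 𝒢^{m,n}_{p,q}(a;b|s;τ) ≠ 0 and 𝒢^{m,n}_{p,q}(a;b|s;τ) = exp( (N/(2τ))·s²·Log(s) + E(s) ) for some E(s) ∈ ℂ with |E(s)| ≤ C·|s|². -/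
open Complex Filter MeasureTheory Set

noncomputable section

/-- The digamma function ψ = Γ'/Γ. -/
def digammaC (z : ℂ) : ℂ := deriv Complex.Gamma z / Complex.Gamma z

/-- The gamma modular form C(τ). -/
def gammaModC (τ : ℂ) : ℂ :=
  limUnder atTop fun M : ℕ =>
    (∑ k ∈ Finset.Ico 1 M, digammaC (k * τ)) + digammaC (M * τ) / 2
      - (1 / τ) * Complex.log (Complex.Gamma (M * τ) / (Real.sqrt (2 * Real.pi) : ℂ))

/-- The gamma modular form D(τ). -/
def gammaModD (τ : ℂ) : ℂ :=
  limUnder atTop fun M : ℕ =>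
    (∑ k ∈ Finset.Ico 1 M, deriv digammaC (k * τ)) + deriv digammaC (M * τ) / 2
      - (1 / τ) * digammaC (M * τ)

def aBarnes (τ : ℂ) : ℂ :=
  -(Real.eulerMascheroniConstant : ℂ) * τ + (τ / 2) * Complex.log (2 * Real.pi * τ)
    + (1 / 2) * Complex.log τ - τ * gammaModC τ

def bBarnes (τ : ℂ) : ℂ :=
  -(Real.pi : ℂ) ^ 2 * τ ^ 2 / 6 - τ * Complex.log τ - τ ^ 2 * gammaModD τ

/-- The Barnes double gamma function `G(z;τ)`, via its Weierstrass product. -/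
def barnesG (z τ : ℂ) : ℂ :=
  z / τ * Complex.exp (aBarnes τ * z / τ + bBarnes τ * z ^ 2 / (2 * τ)) *
    ∏' mn : ℕ × ℕ,
      if mn = (0, 0) then 1
      else (1 + z / (mn.1 * τ + mn.2)) *
        Complex.exp (-(z / (mn.1 * τ + mn.2)) + z ^ 2 / (2 * ((mn.1 : ℂ) * τ + (mn.2 : ℂ)) ^ 2))

/-- The ratio of Barnes double gamma functions `𝒢^{m,n}_{p,q}(a;b | s;τ)`. -/
def calG (m n : ℕ) {p q : ℕ} (a : Fin p → ℂ) (b : Fin q → ℂ) (s τ : ℂ) : ℂ :=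
  ((∏ j : Fin q, if (j : ℕ) < m then barnesG (b j - s) τ else 1) *
      ∏ j : Fin p, if (j : ℕ) < n then barnesG (1 + τ - a j + s) τ else 1) /
    ((∏ j : Fin q, if m ≤ (j : ℕ) then barnesG (1 + τ - b j + s) τ else 1) *
      ∏ j : Fin p, if n ≤ (j : ℕ) then barnesG (a j - s) τ else 1)

/-- `N = 2(m+n) - p - q`. -/
def paramN (m n p q : ℕ) : ℤ := 2 * (m + n) - p - q

/-- `ν = Σ a_j - Σ b_j`. -/
def paramNu {p q : ℕ} (a : Fin p → ℂ) (b : Fin q → ℂ) : ℂ := (∑ j, a j) - ∑ j, b j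

/-- `μ = Σ_{j≤n} a_j - Σ_{j>n} a_j + Σ_{j≤m} b_j - Σ_{j>m} b_j`. -/
def paramMu (m n : ℕ) {p q : ℕ} (a : Fin p → ℂ) (b : Fin q → ℂ) : ℂ :=
  (∑ j : Fin p, if (j : ℕ) < n then a j else 0) - (∑ j : Fin p, if n ≤ (j : ℕ) then a j else 0)
    + (∑ j : Fin q, if (j : ℕ) < m then b j else 0) - ∑ j : Fin q, if m ≤ (j : ℕ) then b j else 0

/-- `ξ = Σ_{j≤n} a_j² - Σ_{j>n} a_j² + Σ_{j≤m} b_j² - Σ_{j>m} b_j²`. -/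
def paramXi (m n : ℕ) {p q : ℕ} (a : Fin p → ℂ) (b : Fin q → ℂ) : ℂ :=
  (∑ j : Fin p, if (j : ℕ) < n then a j ^ 2 else 0)
    - (∑ j : Fin p, if n ≤ (j : ℕ) then a j ^ 2 else 0)
    + (∑ j : Fin q, if (j : ℕ) < m then b j ^ 2 else 0)
    - ∑ j : Fin q, if m ≤ (j : ℕ) then b j ^ 2 else 0

/-- The sector `S⁺_ε = {s ≠ 0 : ε ≤ arg s ≤ π - ε}`. -/
def Splus (ε : ℝ) : Set ℂ := {s | s ≠ 0 ∧ ε ≤ s.arg ∧ s.arg ≤ Real.pi - ε}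

/-- The sector `S⁻_ε = {s ≠ 0 : ε ≤ -arg s ≤ π - ε}`. -/
def Sminus (ε : ℝ) : Set ℂ := {s | s ≠ 0 ∧ ε ≤ -s.arg ∧ -s.arg ≤ Real.pi - ε}

/-- The logarithm of a Weierstrass factor of order two. -/
def logWeierstrass (u : ℂ) : ℂ := Complex.log (1 + u) - u + u ^ 2 / 2

lemma le_norm_one_add_mul {u : ℂ} {δ : ℝ} (hu : u ≠ 0) (h : δ * ‖u‖ ≤ |u.im|) (t : ℝ) :
    δ ≤ ‖1 + t * u‖ := by
  have hu' : 0 < ‖u‖ := norm_pos_iff.2 hu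
  have h1 : ((1 + t * u) * (starRingEnd ℂ) u).im = -u.im := by
    simp; ring
  have h2 : |u.im| ≤ ‖1 + t * u‖ * ‖u‖ := by
    have := Complex.abs_im_le_norm ((1 + t * u) * (starRingEnd ℂ) u)
    rwa [h1, abs_neg, norm_mul, RCLike.norm_conj] at this
  exact le_of_mul_le_mul_right (h.trans h2) hu'

lemma one_add_mul_mem_slitPlane {u : ℂ} (h : u.im ≠ 0) (t : ℝ) :
    1 + t * u ∈ Complex.slitPlane := by
  rw [Complex.mem_slitPlane_iff]
  rcases eq_or_ne t 0 with rfl | ht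
  · simp
  · right; simp [ht, h]

lemma im_ne_zero_of_cone {u : ℂ} {δ : ℝ} (hδ : 0 < δ) (hu : u ≠ 0) (h : δ * ‖u‖ ≤ |u.im|) :
    u.im ≠ 0 := by
  have : 0 < δ * ‖u‖ := mul_pos hδ (norm_pos_iff.2 hu)
  exact abs_pos.1 (this.trans_le h)

lemma hasDerivAt_log_one_add_mul {u : ℂ} (h : u.im ≠ 0) (t : ℝ) :
    HasDerivAt (fun t : ℝ => Complex.log (1 + t * u)) (u / (1 + t * u)) t := by
  have h1 : HasDerivAt (fun t : ℝ => (1 + t * u : ℂ)) u t := by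
    simpa using ((Complex.ofRealCLM.hasDerivAt (x := t)).mul_const u).const_add 1
  exact h1.clog_real (one_add_mul_mem_slitPlane h t)

lemma norm_log_one_add_le_of_cone {u : ℂ} {δ : ℝ} (hδ : 0 < δ) (h : δ * ‖u‖ ≤ |u.im|) :
    ‖Complex.log (1 + u)‖ ≤ ‖u‖ / δ := by
  rcases eq_or_ne u 0 with rfl | hu
  · simp
  have hi := im_ne_zero_of_cone hδ hu h
  have := norm_image_sub_le_of_norm_deriv_le_segment_01' (C := ‖u‖ / δ)
    (fun t _ => (hasDerivAt_log_one_add_mul hi t).hasDerivWithinAt) (fun t _ => by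
      rw [norm_div]
      exact div_le_div_of_nonneg_left (norm_nonneg _) hδ (le_norm_one_add_mul hu h t))
  simpa using this

lemma norm_logWeierstrass_le_of_cone {u : ℂ} {δ : ℝ} (hδ : 0 < δ) (h : δ * ‖u‖ ≤ |u.im|) :
    ‖logWeierstrass u‖ ≤ ‖u‖ ^ 3 / δ := by
  rcases eq_or_ne u 0 with rfl | hu
  · simp [logWeierstrass]
  have hi := im_ne_zero_of_cone hδ hu h
  have hd : ∀ t : ℝ, HasDerivAt
      (fun t : ℝ => Complex.log (1 + t * u) - t * u + (t * u) ^ 2 / 2)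
      (u ^ 3 * t ^ 2 / (1 + t * u)) t := by
    intro t
    have h0 : (1 + t * u : ℂ) ≠ 0 := Complex.slitPlane_ne_zero (one_add_mul_mem_slitPlane hi t)
    have h1 : HasDerivAt (fun t : ℝ => (t * u : ℂ)) u t := by
      simpa using (Complex.ofRealCLM.hasDerivAt (x := t)).mul_const u
    refine (((hasDerivAt_log_one_add_mul hi t).sub h1).add
      ((h1.pow 2).div_const 2)).congr_deriv ?_
    simp only [Nat.cast_ofNat, Nat.add_one_sub_one, pow_one]
    symm
    rw [div_eq_iff h0, add_mul, sub_mul, div_mul_cancel₀ _ h0]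
    ring
  have := norm_image_sub_le_of_norm_deriv_le_segment_01' (C := ‖u‖ ^ 3 / δ)
    (fun t _ => (hd t).hasDerivWithinAt) (fun t ht => by
      rw [norm_div, norm_mul, norm_pow, norm_pow, Complex.norm_real, Real.norm_eq_abs,
        abs_of_nonneg ht.1]
      have : ‖u‖ ^ 3 * t ^ 2 ≤ ‖u‖ ^ 3 :=
        mul_le_of_le_one_right (by positivity) (pow_le_one₀ ht.1 ht.2.le)
      exact div_le_div₀ (by positivity) this hδ (le_norm_one_add_mul hu h t))
  simpa [logWeierstrass] using this

lemma min_one_mul_add_le {τ x y : ℝ} (hx : 0 ≤ x) (hy : 0 ≤ y) :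
    min 1 τ * (x + y) ≤ x * τ + y := by
  nlinarith [mul_le_mul_of_nonneg_left (min_le_right 1 τ) hx,
    mul_le_mul_of_nonneg_left (min_le_left 1 τ) hy]

lemma sum_range_inv_mul_succ {τ k : ℝ} (hτ : 0 < τ) (hk : 0 < k) (j : ℕ) (hj : j ≤ k) :
    ∑ m ∈ Finset.range j, ((m * τ + (k - m)) * ((m + 1) * τ + (k - (m + 1))))⁻¹
      = j / (k * (j * τ + (k - j))) := by
  induction j with
  | zero => simp
  | succ j ih =>
    push_cast at hj ⊢
    have h1 : (0 : ℝ) < j * τ + (k - j) := by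
      have : 0 ≤ (j : ℝ) * τ := by positivity
      linarith
    have h2 : (0 : ℝ) < (j + 1) * τ + (k - (j + 1)) := by
      have : 0 < ((j : ℝ) + 1) * τ := by positivity
      linarith
    rw [Finset.sum_range_succ, ih (by linarith)]
    have h3 : j * ((j + 1) * τ + (k - (j + 1))) + k = (j + 1) * (j * τ + (k - j)) := by ring
    generalize (j + 1) * τ + (k - (j + 1)) = y at *
    generalize j * τ + (k - j) = x at *
    field_simp
    linarith

lemma abs_sum_inv_sq_sub_le {τ : ℝ} (hτ : 0 < τ) {k : ℕ} (hk : 1 ≤ k) :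
    |∑ m ∈ Finset.range (k + 1), ((m * τ + (k - m : ℝ)) ^ 2)⁻¹ - (τ * k)⁻¹|
      ≤ (|1 - τ| / min 1 τ ^ 3 + (τ ^ 2)⁻¹) * ((k : ℝ) ^ 2)⁻¹ := by
  have hk' : (0 : ℝ) < k := by exact_mod_cast hk
  have hc : 0 < min 1 τ := lt_min one_pos hτ
  have hlow : ∀ x : ℝ, 0 ≤ x → x ≤ k → min 1 τ * k ≤ x * τ + (k - x) := fun x h0 h1 => by
    simpa using min_one_mul_add_le (τ := τ) h0 (sub_nonneg.2 h1)
  have htel := sum_range_inv_mul_succ hτ hk' k le_rfl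
  have htel' : (k : ℝ) / (k * (k * τ + (k - k))) = (τ * k)⁻¹ := by
    rw [sub_self, add_zero]; field_simp
  rw [Finset.sum_range_succ, ← htel', ← htel, add_sub_right_comm, ← Finset.sum_sub_distrib]
  refine (abs_add_le _ _).trans ?_
  have hlast : |((k * τ + (k - k : ℝ)) ^ 2)⁻¹| = (τ ^ 2)⁻¹ * ((k : ℝ) ^ 2)⁻¹ := by
    rw [abs_of_nonneg (by positivity)]
    simp [mul_pow, mul_comm]
  rw [hlast, add_mul]
  gcongr
  refine (Finset.abs_sum_le_sum_abs _ _).trans ?_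
  have : ∀ m ∈ Finset.range k, |((m * τ + (k - m : ℝ)) ^ 2)⁻¹
      - ((m * τ + (k - m)) * ((m + 1) * τ + (k - (m + 1))))⁻¹|
      ≤ |1 - τ| / (min 1 τ * k) ^ 3 := by
    intro m hm
    have hm' : (m : ℝ) + 1 ≤ k := by exact_mod_cast Finset.mem_range.1 hm
    have h1 := hlow m (by positivity) (by linarith)
    have h2 := hlow (m + 1) (by positivity) hm'
    have h0 : 0 < min 1 τ * k := by positivity
    set x := m * τ + (k - m : ℝ) with hx
    set y := ((m : ℝ) + 1) * τ + (k - (m + 1)) with hy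
    have hyx : y - x = τ - 1 := by rw [hx, hy]; ring
    have hx0 := h0.trans_le h1
    have hy0 := h0.trans_le h2
    have : (x ^ 2)⁻¹ - (x * y)⁻¹ = -(1 - τ) / (x ^ 2 * y) := by
      field_simp; linarith
    rw [this, abs_div, abs_neg, abs_of_pos (by positivity : 0 < x ^ 2 * y)]
    gcongr
    calc (min 1 τ * k) ^ 3 = (min 1 τ * k) ^ 2 * (min 1 τ * k) := by ring
      _ ≤ _ := by gcongr
  refine (Finset.sum_le_sum this).trans (le_of_eq ?_)
  simp only [Finset.sum_const, Finset.card_range, nsmul_eq_mul]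
  field_simp

lemma cone_div {z : ℂ} {δ : ℝ} (h : δ * ‖z‖ ≤ |z.im|) (w : ℝ) :
    δ * ‖z / w‖ ≤ |(z / w).im| := by
  rw [norm_div, Complex.norm_real, Real.norm_eq_abs, Complex.div_ofReal_im, abs_div, ← mul_div_assoc]
  gcongr

lemma norm_div_lattice_le {τ : ℝ} (hτ : 0 < τ) (z : ℂ) (p : ℕ × ℕ) :
    ‖z / ((p.1 * τ + p.2 : ℝ) : ℂ)‖ ≤ ‖z‖ / (min 1 τ * (p.1 + p.2 : ℕ)) := by
  have hc : 0 < min 1 τ := lt_min one_pos hτ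
  rw [norm_div, Complex.norm_real, Real.norm_eq_abs, abs_of_nonneg (by positivity)]
  rcases eq_or_ne p 0 with rfl | hp
  · simp
  have : 0 < p.1 + p.2 := by
    rcases p with ⟨a, b⟩
    simp only [ne_eq, Prod.mk_eq_zero, not_and] at hp
    dsimp only
    lia
  have : (0 : ℝ) < (p.1 + p.2 : ℕ) := by exact_mod_cast this
  gcongr
  push_cast
  exact min_one_mul_add_le (by positivity) (by positivity)

lemma succ_div_pow_three_le {k : ℕ} (hk : 1 ≤ k) :
    ((k : ℝ) + 1) * ((k : ℝ) ^ 3)⁻¹ ≤ 2 * ((k : ℝ) ^ 2)⁻¹ := by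
  have hk' : (1 : ℝ) ≤ k := by exact_mod_cast hk
  have : ((k : ℝ) ^ 2)⁻¹ = k * ((k : ℝ) ^ 3)⁻¹ := by field_simp
  rw [this, ← mul_assoc]
  gcongr
  linarith

lemma summable_inv_add_pow_three :
    Summable fun p : ℕ × ℕ => (((p.1 + p.2 : ℕ) : ℝ) ^ 3)⁻¹ := by
  rw [← Finset.HasAntidiagonal.sigmaAntidiagonalEquivProd.summable_iff,
    summable_sigma_of_nonneg (fun _ => by simp only [Function.comp_apply]; positivity)]
  refine ⟨fun k => (hasSum_fintype _).summable, ?_⟩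
  refine Summable.of_norm_bounded_eventually_nat
    ((Real.summable_nat_pow_inv.2 one_lt_two).mul_left 2) ?_
  filter_upwards [eventually_ge_atTop 1] with k hk
  refine le_trans (le_of_eq ?_) (succ_div_pow_three_le hk)
  have : ∀ c : Finset.HasAntidiagonal.antidiagonal k, c.1.1 + c.1.2 = k :=
    fun c => Finset.HasAntidiagonal.mem_antidiagonal.1 c.2
  simp only [Function.comp_apply, Finset.HasAntidiagonal.sigmaAntidiagonalEquivProd_apply, this,
    tsum_fintype, Finset.sum_const, Finset.card_univ, Fintype.card_coe,
    Finset.Nat.card_antidiagonal, nsmul_eq_mul]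
  rw [Real.norm_of_nonneg (by positivity)]
  push_cast
  ring

/-- The logarithm of the product of the Weierstrass factors over the `k`-th antidiagonal. -/
def antidiagonalLog (τ : ℝ) (z : ℂ) (k : ℕ) : ℂ :=
  ∑ p ∈ Finset.HasAntidiagonal.antidiagonal k, logWeierstrass (z / ((p.1 * τ + p.2 : ℝ) : ℂ))

lemma summable_logWeierstrass {τ δ : ℝ} (hτ : 0 < τ) (hδ : 0 < δ) {z : ℂ}
    (h : δ * ‖z‖ ≤ |z.im|) :
    Summable fun p : ℕ × ℕ => logWeierstrass (z / ((p.1 * τ + p.2 : ℝ) : ℂ)) := by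
  have hc : 0 < min 1 τ := lt_min one_pos hτ
  refine Summable.of_norm_bounded
    (summable_inv_add_pow_three.mul_left (‖z‖ ^ 3 / min 1 τ ^ 3 / δ)) fun p => ?_
  refine (norm_logWeierstrass_le_of_cone hδ (cone_div h _)).trans ?_
  calc _ ≤ (‖z‖ / (min 1 τ * (p.1 + p.2 : ℕ))) ^ 3 / δ := by
        gcongr; exact norm_div_lattice_le hτ z p
    _ = _ := by rw [div_pow, mul_pow, ← div_div]; ring

lemma norm_sum_antidiagonal_le {f : ℕ × ℕ → ℂ} {k : ℕ} {B : ℝ}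
    (h : ∀ p ∈ Finset.HasAntidiagonal.antidiagonal k, ‖f p‖ ≤ B) :
    ‖∑ p ∈ Finset.HasAntidiagonal.antidiagonal k, f p‖ ≤ (k + 1) * B := by
  refine (norm_sum_le_of_le _ h).trans (le_of_eq ?_)
  simp

lemma norm_antidiagonalLog_le {τ δ : ℝ} (hτ : 0 < τ) (hδ : 0 < δ) {z : ℂ}
    (h : δ * ‖z‖ ≤ |z.im|) {k : ℕ} (hk : 1 ≤ k) :
    ‖antidiagonalLog τ z k‖ ≤ 2 / (min 1 τ ^ 3 * δ) * ‖z‖ ^ 3 * ((k : ℝ) ^ 2)⁻¹ := by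
  have hc : 0 < min 1 τ := lt_min one_pos hτ
  refine (norm_sum_antidiagonal_le (B := (‖z‖ / (min 1 τ * k)) ^ 3 / δ) fun p hp => ?_).trans ?_
  · refine (norm_logWeierstrass_le_of_cone hδ (cone_div h _)).trans ?_
    gcongr
    simpa only [Finset.HasAntidiagonal.mem_antidiagonal.1 hp] using norm_div_lattice_le hτ z p
  · calc _ = (‖z‖ ^ 3 / min 1 τ ^ 3 / δ) * (((k : ℝ) + 1) * ((k : ℝ) ^ 3)⁻¹) := by
          rw [div_pow, mul_pow, ← div_div]; ring
      _ ≤ (‖z‖ ^ 3 / min 1 τ ^ 3 / δ) * (2 * ((k : ℝ) ^ 2)⁻¹) :=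
          mul_le_mul_of_nonneg_left (succ_div_pow_three_le hk) (by positivity)
      _ = _ := by field_simp

lemma norm_antidiagonalLog_sub_le {τ δ : ℝ} (hτ : 0 < τ) (hδ : 0 < δ) {z : ℂ}
    (h : δ * ‖z‖ ≤ |z.im|) {k : ℕ} (hk : 1 ≤ k) :
    ‖antidiagonalLog τ z k - z ^ 2 / (2 * τ) * (k : ℂ)⁻¹‖ ≤
      2 * (1 / δ + 1) / min 1 τ * ‖z‖ +
        (|1 - τ| / min 1 τ ^ 3 + (τ ^ 2)⁻¹) * ‖z‖ ^ 2 * ((k : ℝ) ^ 2)⁻¹ := by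
  have hc : 0 < min 1 τ := lt_min one_pos hτ
  have hk1 : (1 : ℝ) ≤ k := by exact_mod_cast hk
  have hk0 : (k : ℂ) ≠ 0 := by exact_mod_cast (by lia : k ≠ 0)
  have hτ0 : (τ : ℂ) ≠ 0 := by exact_mod_cast hτ.ne'
  have hsplit : antidiagonalLog τ z k - z ^ 2 / (2 * τ) * (k : ℂ)⁻¹ =
      ∑ p ∈ Finset.HasAntidiagonal.antidiagonal k, (Complex.log (1 + z / ((p.1 * τ + p.2 : ℝ) : ℂ))
        - z / ((p.1 * τ + p.2 : ℝ) : ℂ)) +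
      z ^ 2 / 2 * ((∑ m ∈ Finset.range (k + 1), ((m * τ + (k - m : ℝ)) ^ 2)⁻¹
        - (τ * k)⁻¹ : ℝ) : ℂ) := by
    have : ∑ m ∈ Finset.range (k + 1), ((m * τ + (k - m : ℝ)) ^ 2)⁻¹ =
        ∑ p ∈ Finset.HasAntidiagonal.antidiagonal k, ((p.1 * τ + p.2) ^ 2)⁻¹ := by
      rw [Finset.Nat.sum_antidiagonal_eq_sum_range_succ_mk]
      refine Finset.sum_congr rfl fun m hm => ?_
      rw [Nat.cast_sub (Finset.mem_range_succ_iff.1 hm)]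
    rw [this, antidiagonalLog]
    push_cast
    rw [mul_sub, Finset.mul_sum, ← add_sub_assoc, ← Finset.sum_add_distrib]
    congr 1
    · refine Finset.sum_congr rfl fun p _ => ?_
      rw [logWeierstrass, div_pow]
      ring
    · field_simp
  rw [hsplit]
  refine (norm_add_le _ _).trans (add_le_add ?_ ?_)
  · refine (norm_sum_antidiagonal_le (B := (1 / δ + 1) * (‖z‖ / (min 1 τ * k)))
      fun p hp => ?_).trans ?_
    · have h1 := norm_log_one_add_le_of_cone hδ (cone_div h (p.1 * τ + p.2))
      have h2 := norm_div_lattice_le hτ z p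
      rw [Finset.HasAntidiagonal.mem_antidiagonal.1 hp] at h2
      refine (norm_sub_le _ _).trans ((add_le_add_left h1 _).trans ?_)
      calc _ = (1 / δ + 1) * ‖z / ((p.1 * τ + p.2 : ℝ) : ℂ)‖ := by ring
        _ ≤ _ := by gcongr
    · calc _ = ((k : ℝ) + 1) / k * ((1 / δ + 1) / min 1 τ * ‖z‖) := by
            field_simp
        _ ≤ 2 * ((1 / δ + 1) / min 1 τ * ‖z‖) := by
            gcongr
            rw [div_le_iff₀ (by linarith)]
            linarith
        _ = _ := by ring
  · rw [norm_mul, Complex.norm_real, Real.norm_eq_abs, norm_div, norm_pow]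
    have := abs_sum_inv_sq_sub_le hτ hk
    calc _ ≤ ‖z‖ ^ 2 * ((|1 - τ| / min 1 τ ^ 3 + (τ ^ 2)⁻¹) * ((k : ℝ) ^ 2)⁻¹) := by
          gcongr
          simp
      _ = _ := by ring

lemma antidiagonalLog_zero (τ : ℝ) (z : ℂ) : antidiagonalLog τ z 0 = 0 := by
  simp [antidiagonalLog, logWeierstrass]

lemma sum_range_eq_sum_Ioo {M n : ℕ} (hn : M < n) (f : ℕ → ℂ) (h0 : f 0 = 0) :
    ∑ k ∈ Finset.range n, f k =
      ∑ k ∈ Finset.Ioo 0 (M + 1), f k + ∑ k ∈ Finset.Ioo M n, f k := by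
  rw [Finset.range_eq_Ico, ← Finset.sum_Ico_consecutive f (Nat.zero_le (M + 1)) hn,
    Finset.sum_eq_sum_Ico_succ_bot (Nat.succ_pos M), h0, zero_add]
  rfl

lemma exists_norm_tsum_logWeierstrass_sub_le {τ δ : ℝ} (hτ : 0 < τ) (hδ : 0 < δ) :
    ∃ C : ℝ, ∀ z : ℂ, 1 ≤ ‖z‖ → δ * ‖z‖ ≤ |z.im| →
      ‖∑' p : ℕ × ℕ, logWeierstrass (z / ((p.1 * τ + p.2 : ℝ) : ℂ))
        - z ^ 2 / (2 * τ) * Real.log ‖z‖‖ ≤ C * ‖z‖ ^ 2 := by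
  have hc : 0 < min 1 τ := lt_min one_pos hτ
  obtain ⟨K1, K2, K3, hK1, hK2, hK3, hmid, htail⟩ : ∃ K1 K2 K3 : ℝ, 0 ≤ K1 ∧ 0 ≤ K2 ∧ 0 ≤ K3 ∧
      (∀ z : ℂ, δ * ‖z‖ ≤ |z.im| → ∀ k : ℕ, 1 ≤ k →
        ‖antidiagonalLog τ z k - z ^ 2 / (2 * τ) * (k : ℂ)⁻¹‖ ≤
          K1 * ‖z‖ + K2 * ‖z‖ ^ 2 * ((k : ℝ) ^ 2)⁻¹) ∧
      ∀ z : ℂ, δ * ‖z‖ ≤ |z.im| → ∀ k : ℕ, 1 ≤ k →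
        ‖antidiagonalLog τ z k‖ ≤ K3 * ‖z‖ ^ 3 * ((k : ℝ) ^ 2)⁻¹ :=
    ⟨_, _, _, by positivity, by positivity, by positivity,
      fun z h k hk => norm_antidiagonalLog_sub_le hτ hδ h hk,
      fun z h k hk => norm_antidiagonalLog_le hτ hδ h hk⟩
  refine ⟨K1 + 2 * K2 + 2 * K3 + 1 / (2 * τ), fun z hz h => ?_⟩
  set M := ⌊‖z‖⌋₊ with hM
  have hMle : (M : ℝ) ≤ ‖z‖ := Nat.floor_le (norm_nonneg _)
  have hMlt : ‖z‖ < M + 1 := Nat.lt_floor_add_one _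
  have hsum : HasSum (antidiagonalLog τ z)
      (∑' p : ℕ × ℕ, logWeierstrass (z / ((p.1 * τ + p.2 : ℝ) : ℂ))) := by
    have := (summable_logWeierstrass hτ hδ h).hasSum
    rw [← Finset.HasAntidiagonal.sigmaAntidiagonalEquivProd.hasSum_iff] at this
    exact this.sigma fun k => Finset.hasSum (Finset.HasAntidiagonal.antidiagonal k) _
  refine le_of_tendsto ((hsum.tendsto_sum_nat.sub_const _).norm) ?_
  filter_upwards [eventually_gt_atTop M] with n hn
  rw [sum_range_eq_sum_Ioo hn _ (antidiagonalLog_zero τ z)]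
  have hharm : ((harmonic M : ℚ) : ℂ) = ∑ k ∈ Finset.Ioo 0 (M + 1), (k : ℂ)⁻¹ := by
    rw [harmonic_eq_sum_Icc]
    push_cast
    rfl
  have hlog : |((harmonic M : ℚ) : ℝ) - Real.log ‖z‖| ≤ 1 := by
    rw [abs_le]
    constructor <;>
      linarith [log_le_harmonic_floor ‖z‖ (norm_nonneg _), harmonic_floor_le_one_add_log ‖z‖ hz]
  have key : ∑ k ∈ Finset.Ioo 0 (M + 1), antidiagonalLog τ z k
      + ∑ k ∈ Finset.Ioo M n, antidiagonalLog τ z k - z ^ 2 / (2 * τ) * Real.log ‖z‖ =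
      ∑ k ∈ Finset.Ioo 0 (M + 1), (antidiagonalLog τ z k - z ^ 2 / (2 * τ) * (k : ℂ)⁻¹)
      + ∑ k ∈ Finset.Ioo M n, antidiagonalLog τ z k
      + z ^ 2 / (2 * τ) * ((((harmonic M : ℚ) : ℝ) - Real.log ‖z‖ : ℝ) : ℂ) := by
    rw [Finset.sum_sub_distrib, ← Finset.mul_sum, ← hharm]
    push_cast
    ring
  rw [key]
  have b1 : ‖∑ k ∈ Finset.Ioo 0 (M + 1), (antidiagonalLog τ z k - z ^ 2 / (2 * τ) * (k : ℂ)⁻¹)‖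
      ≤ (K1 + 2 * K2) * ‖z‖ ^ 2 := by
    refine (norm_sum_le_of_le _ fun k hk =>
      hmid z h k (Finset.mem_Ioo.1 hk).1).trans ?_
    rw [Finset.sum_add_distrib, Finset.sum_const, nsmul_eq_mul, Nat.card_Ioo, ← Finset.mul_sum]
    have := sum_Ioo_inv_sq_le (α := ℝ) 0 (M + 1)
    have hcard : ((M + 1 - 0 - 1 : ℕ) : ℝ) ≤ ‖z‖ := by simpa using hMle
    calc _ ≤ ‖z‖ * (K1 * ‖z‖) + K2 * ‖z‖ ^ 2 * (2 / ((0 : ℕ) + 1)) :=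
          add_le_add (mul_le_mul_of_nonneg_right hcard (by positivity))
            (mul_le_mul_of_nonneg_left this (by positivity))
      _ = _ := by simp; ring
  have b2 : ‖∑ k ∈ Finset.Ioo M n, antidiagonalLog τ z k‖ ≤ 2 * K3 * ‖z‖ ^ 2 := by
    refine (norm_sum_le_of_le _ fun k hk =>
      htail z h k (by have := (Finset.mem_Ioo.1 hk).1; lia)).trans ?_
    rw [← Finset.mul_sum]
    calc _ ≤ K3 * ‖z‖ ^ 3 * (2 / (M + 1)) := by
          gcongr; exact sum_Ioo_inv_sq_le M n
      _ ≤ K3 * ‖z‖ ^ 3 * (2 / ‖z‖) := by gcongr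
      _ = _ := by field_simp
  have b3 : ‖z ^ 2 / (2 * τ) * ((((harmonic M : ℚ) : ℝ) - Real.log ‖z‖ : ℝ) : ℂ)‖
      ≤ 1 / (2 * τ) * ‖z‖ ^ 2 := by
    rw [norm_mul, Complex.norm_real, Real.norm_eq_abs]
    calc _ ≤ ‖z ^ 2 / (2 * τ)‖ * 1 := by gcongr
      _ = _ := by simp [abs_of_pos hτ]; ring
  refine (norm_add₃_le).trans ?_
  linarith

lemma barnesG_eq_exp_of_cone {τ δ : ℝ} (hτ : 0 < τ) (hδ : 0 < δ) {z : ℂ} (hz : z ≠ 0)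
    (h : δ * ‖z‖ ≤ |z.im|) :
    barnesG z τ = Complex.exp (Complex.log z - Complex.log τ
      + (aBarnes τ * z / τ + bBarnes τ * z ^ 2 / (2 * τ))
      + ∑' p : ℕ × ℕ, logWeierstrass (z / ((p.1 * τ + p.2 : ℝ) : ℂ))) := by
  have hprod := (summable_logWeierstrass hτ hδ h).hasSum.cexp.tprod_eq
  rw [Complex.exp_add, Complex.exp_add, Complex.exp_sub, Complex.exp_log hz,
    Complex.exp_log (by exact_mod_cast hτ.ne'), ← hprod, barnesG]
  congr 1
  refine tprod_congr fun p => ?_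
  rcases eq_or_ne p (0, 0) with rfl | hp
  · simp [logWeierstrass]
  rw [if_neg hp, Function.comp_apply]
  have him : 1 + z / ((p.1 * τ + p.2 : ℝ) : ℂ) ≠ 0 := by
    have hp' : 0 < p.1 * τ + p.2 := by
      rcases Nat.eq_zero_or_pos p.1 with h1 | h1
      · have : 0 < p.2 := Nat.pos_of_ne_zero fun h2 => hp (Prod.ext h1 h2)
        positivity
      · positivity
    have hu : z / ((p.1 * τ + p.2 : ℝ) : ℂ) ≠ 0 :=
      div_ne_zero hz (by exact_mod_cast hp'.ne')
    simpa using Complex.slitPlane_ne_zero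
      (one_add_mul_mem_slitPlane (im_ne_zero_of_cone hδ hu (cone_div h _)) 1)
  rw [logWeierstrass, sub_eq_add_neg, add_assoc, Complex.exp_add (Complex.log _), Complex.exp_log him]
  push_cast
  rw [div_pow, div_div, mul_comm (2 : ℂ)]

lemma exists_barnesG_eq_exp {τ δ : ℝ} (hτ : 0 < τ) (hδ : 0 < δ) :
    ∃ C : ℝ, ∀ z : ℂ, 1 ≤ ‖z‖ → δ * ‖z‖ ≤ |z.im| → ∃ E : ℂ, ‖E‖ ≤ C * ‖z‖ ^ 2 ∧
      barnesG z τ = Complex.exp (z ^ 2 / (2 * τ) * Real.log ‖z‖ + E) := by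
  obtain ⟨C, hC⟩ := exists_norm_tsum_logWeierstrass_sub_le hτ hδ
  refine ⟨1 + Real.pi + ‖Complex.log τ‖ + ‖aBarnes τ / τ‖ + ‖bBarnes τ / (2 * τ)‖ + C,
    fun z hz h => ?_⟩
  have hz0 : z ≠ 0 := norm_pos_iff.1 (by linarith)
  refine ⟨_, ?_, (barnesG_eq_exp_of_cone hτ hδ hz0 h).trans (congrArg _
    (add_sub_cancel (z ^ 2 / (2 * τ) * Real.log ‖z‖) _).symm)⟩
  rw [add_sub_assoc]
  have h1 : 1 ≤ ‖z‖ ^ 2 := one_le_pow₀ hz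
  have h2 : ‖z‖ ≤ ‖z‖ ^ 2 := le_self_pow₀ hz two_ne_zero
  have hlog : ‖Complex.log z‖ ≤ (1 + Real.pi) * ‖z‖ ^ 2 := by
    refine (Complex.norm_le_abs_re_add_abs_im _).trans ?_
    rw [Complex.log_re, Complex.log_im, abs_of_nonneg (Real.log_nonneg hz)]
    nlinarith [Complex.abs_arg_le_pi z, Real.log_le_self (norm_nonneg z), Real.pi_pos]
  have hτlog : ‖Complex.log τ‖ ≤ ‖Complex.log τ‖ * ‖z‖ ^ 2 :=
    le_mul_of_one_le_right (norm_nonneg _) h1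
  have ha : ‖aBarnes τ * z / τ‖ ≤ ‖aBarnes τ / τ‖ * ‖z‖ ^ 2 := by
    rw [mul_div_right_comm, norm_mul]
    gcongr
  have hb : ‖bBarnes τ * z ^ 2 / (2 * τ)‖ = ‖bBarnes τ / (2 * τ)‖ * ‖z‖ ^ 2 := by
    rw [mul_div_right_comm, norm_mul, norm_pow]
  calc _ ≤ ‖Complex.log z‖ + ‖Complex.log τ‖ +
        (‖aBarnes τ * z / τ‖ + ‖bBarnes τ * z ^ 2 / (2 * τ)‖) + C * ‖z‖ ^ 2 :=
        (norm_add_le _ _).trans (add_le_add ((norm_add_le _ _).trans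
          (add_le_add (norm_sub_le _ _) (norm_add_le _ _))) (hC z hz h))
    _ ≤ _ := by linarith

/-- The filter of neighbourhoods of infinity within the double sector `δ * ‖s‖ ≤ |s.im|`. -/
def coneAtInfinity (δ : ℝ) : Filter ℂ :=
  Bornology.cobounded ℂ ⊓ 𝓟 {s | δ * ‖s‖ ≤ |s.im|}

lemma eventually_coneAtInfinity {δ : ℝ} {P : ℂ → Prop} :
    (∀ᶠ s in coneAtInfinity δ, P s) ↔
      ∃ R : ℝ, ∀ s : ℂ, R ≤ ‖s‖ → δ * ‖s‖ ≤ |s.im| → P s := by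
  rw [coneAtInfinity, eventually_inf_principal, ← comap_norm_atTop,
    (atTop_basis.comap _).eventually_iff]
  simp

/-- `f s = exp (κ s² log s + O(s²))` along the filter `l`. -/
def IsLogQuadratic (l : Filter ℂ) (κ : ℂ) (f : ℂ → ℂ) : Prop :=
  ∃ E : ℂ → ℂ, Asymptotics.IsBigO l E (fun s => s ^ 2) ∧
    ∀ᶠ s in l, f s = Complex.exp (κ * s ^ 2 * Complex.log s + E s)

namespace IsLogQuadratic

variable {l : Filter ℂ} {κ κ' : ℂ} {f g : ℂ → ℂ}

lemma one : IsLogQuadratic l 0 fun _ => 1 :=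
  ⟨0, Asymptotics.isBigO_zero _ _, by simp⟩

lemma mul (hf : IsLogQuadratic l κ f) (hg : IsLogQuadratic l κ' g) :
    IsLogQuadratic l (κ + κ') fun s => f s * g s := by
  obtain ⟨E, hE, hfE⟩ := hf
  obtain ⟨F, hF, hgF⟩ := hg
  refine ⟨_, hE.add hF, ?_⟩
  filter_upwards [hfE, hgF] with s h1 h2
  rw [h1, h2, ← Complex.exp_add]
  ring_nf

lemma div (hf : IsLogQuadratic l κ f) (hg : IsLogQuadratic l κ' g) :
    IsLogQuadratic l (κ - κ') fun s => f s / g s := by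
  obtain ⟨E, hE, hfE⟩ := hf
  obtain ⟨F, hF, hgF⟩ := hg
  refine ⟨_, hE.sub hF, ?_⟩
  filter_upwards [hfE, hgF] with s h1 h2
  rw [h1, h2, ← Complex.exp_sub]
  ring_nf

lemma prod_ite {ι : Type*} (t : Finset ι) (P : ι → Prop) [DecidablePred P] {f : ι → ℂ → ℂ}
    (hf : ∀ i, IsLogQuadratic l κ (f i)) :
    IsLogQuadratic l ((t.filter P).card * κ) fun s => ∏ i ∈ t, if P i then f i s else 1 := by
  classical
  induction t using Finset.induction_on with
  | empty => simpa using one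
  | insert i t hi ih =>
    simp only [Finset.prod_insert hi, Finset.filter_insert]
    split_ifs with hP
    · rw [Finset.card_insert_of_notMem (by simp [hi])]
      convert (hf i).mul ih using 1
      push_cast
      ring
    · simpa using ih

end IsLogQuadratic

lemma norm_ofReal_log_norm_sub_log_le {s z : ℂ} (hs : s ≠ 0) (h1 : ‖s‖ / 2 ≤ ‖z‖)
    (h2 : ‖z‖ ≤ 2 * ‖s‖) : ‖(Real.log ‖z‖ : ℂ) - Complex.log s‖ ≤ 1 + Real.pi := by
  have hs0 : 0 < ‖s‖ := norm_pos_iff.2 hs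
  have hz0 : 0 < ‖z‖ := by linarith
  refine (Complex.norm_le_abs_re_add_abs_im _).trans (add_le_add ?_ ?_)
  · have hlog2 : Real.log 2 ≤ 1 := by linarith [Real.log_two_lt_d9]
    have a1 := Real.log_le_log (by positivity) h1
    have a2 := Real.log_le_log hz0 h2
    rw [Real.log_div hs0.ne' two_ne_zero] at a1
    rw [Real.log_mul two_ne_zero hs0.ne'] at a2
    rw [Complex.sub_re, Complex.ofReal_re, Complex.log_re, abs_le]
    constructor <;> linarith
  · rw [Complex.sub_im, Complex.ofReal_im, zero_sub, abs_neg, Complex.log_im]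
    exact Complex.abs_arg_le_pi s

lemma isLogQuadratic_barnesG {τ δ : ℝ} (hτ : 0 < τ) (hδ : 0 < δ) (c σ : ℂ)
    (hσ : σ = 1 ∨ σ = -1) :
    IsLogQuadratic (coneAtInfinity δ) (1 / (2 * τ)) fun s => barnesG (c + σ * s) τ := by
  obtain ⟨C, hC⟩ := exists_barnesG_eq_exp hτ (δ := δ / 4) (by positivity)
  choose! E hE using hC
  have hσ2 : σ ^ 2 = 1 := by rcases hσ with rfl | rfl <;> norm_num
  have hσn : ‖σ‖ = 1 := by rcases hσ with rfl | rfl <;> simp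
  have hlarge : ∀ᶠ s in coneAtInfinity δ, (2 ≤ ‖s‖ ∧ 2 * ‖c‖ ≤ ‖s‖ ∧ 2 * ‖c‖ ≤ δ * ‖s‖) ∧
      δ * ‖s‖ ≤ |s.im| := by
    refine eventually_coneAtInfinity.2 ⟨max 2 (max (2 * ‖c‖) (2 * ‖c‖ / δ)), fun s hs h => ?_⟩
    simp only [max_le_iff, div_le_iff₀ hδ] at hs
    exact ⟨⟨hs.1, hs.2.1, by linarith [hs.2.2]⟩, h⟩
  have hshift : ∀ s : ℂ, (2 ≤ ‖s‖ ∧ 2 * ‖c‖ ≤ ‖s‖ ∧ 2 * ‖c‖ ≤ δ * ‖s‖) ∧ δ * ‖s‖ ≤ |s.im| →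
      ‖s‖ / 2 ≤ ‖c + σ * s‖ ∧ ‖c + σ * s‖ ≤ 2 * ‖s‖ ∧ 1 ≤ ‖c + σ * s‖ ∧
        δ / 4 * ‖c + σ * s‖ ≤ |(c + σ * s).im| := by
    rintro s ⟨⟨h1, h2, h3⟩, h4⟩
    have hn : ‖σ * s‖ = ‖s‖ := by rw [norm_mul, hσn, one_mul]
    have h5 : ‖c + σ * s‖ ≤ 2 * ‖s‖ := by
      linarith [norm_add_le c (σ * s), norm_nonneg c]
    have h6 : ‖s‖ / 2 ≤ ‖c + σ * s‖ := by
      have := norm_sub_le (c + σ * s) c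
      rw [add_sub_cancel_left] at this
      linarith
    refine ⟨h6, h5, by linarith, ?_⟩
    have h7 : |(σ * s).im| = |s.im| := by rcases hσ with rfl | rfl <;> simp
    have h8 := abs_sub_abs_le_abs_sub (σ * s).im (-c.im)
    rw [abs_neg, h7, sub_neg_eq_add, add_comm, ← Complex.add_im] at h8
    have h9 := Complex.abs_im_le_norm c
    have h10 : δ / 4 * ‖c + σ * s‖ ≤ δ / 4 * (2 * ‖s‖) := by gcongr
    linarith
  refine ⟨fun s => E (c + σ * s) +
    (s ^ 2 * (Real.log ‖c + σ * s‖ - Complex.log s)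
      + (2 * c * σ * s + c ^ 2) * Real.log ‖c + σ * s‖) / (2 * τ), ?_, ?_⟩
  · refine Asymptotics.IsBigO.of_bound (|C| * 4 + (1 + Real.pi + 6 * ‖c‖) / (2 * τ)) ?_
    filter_upwards [hlarge] with s hs
    obtain ⟨z1, z2, z3, z4⟩ := hshift s hs
    have hs0 : s ≠ 0 := norm_pos_iff.1 (by linarith [hs.1.1])
    have e1 : ‖E (c + σ * s)‖ ≤ |C| * 4 * ‖s‖ ^ 2 := by
      calc _ ≤ C * ‖c + σ * s‖ ^ 2 := (hE _ z3 z4).1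
        _ ≤ |C| * (2 * ‖s‖) ^ 2 := by gcongr; exact le_abs_self C
        _ = _ := by ring
    have e2 := norm_ofReal_log_norm_sub_log_le hs0 z1 z2
    have e3 : ‖(Real.log ‖c + σ * s‖ : ℂ)‖ ≤ 2 * ‖s‖ := by
      rw [Complex.norm_real, Real.norm_of_nonneg (Real.log_nonneg z3)]
      exact (Real.log_le_self (norm_nonneg _)).trans z2
    have e4 : ‖2 * c * σ * s + c ^ 2‖ ≤ 3 * ‖c‖ * ‖s‖ := by
      refine (norm_add_le _ _).trans ?_
      simp only [norm_mul, norm_pow, hσn, Complex.norm_ofNat]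
      nlinarith [norm_nonneg c, hs.1.2.1]
    have e5 : ‖(2 * τ : ℂ)‖ = 2 * τ := by
      rw [norm_mul, Complex.norm_real, Real.norm_of_nonneg hτ.le, Complex.norm_ofNat]
    calc _ ≤ |C| * 4 * ‖s‖ ^ 2 +
          (‖s‖ ^ 2 * (1 + Real.pi) + 3 * ‖c‖ * ‖s‖ * (2 * ‖s‖)) / (2 * τ) := by
          refine (norm_add_le _ _).trans (add_le_add e1 ?_)
          rw [norm_div, e5]
          gcongr
          refine (norm_add_le _ _).trans ?_
          rw [norm_mul, norm_mul, norm_pow]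
          gcongr
      _ = _ := by rw [norm_pow]; ring
  · filter_upwards [hlarge] with s hs
    obtain ⟨z1, z2, z3, z4⟩ := hshift s hs
    rw [(hE _ z3 z4).2]
    congr 1
    have : (c + σ * s) ^ 2 = s ^ 2 + (2 * c * σ * s + c ^ 2) := by
      linear_combination s ^ 2 * hσ2
    rw [this]
    ring

lemma isLogQuadratic_calG {τ δ : ℝ} (hτ : 0 < τ) (hδ : 0 < δ) {m n p q : ℕ} (hm : m ≤ q)
    (hn : n ≤ p) (a : Fin p → ℂ) (b : Fin q → ℂ) :
    IsLogQuadratic (coneAtInfinity δ) (paramN m n p q / (2 * τ))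
      fun s => calG m n a b s τ := by
  have hminus : ∀ c : ℂ,
      IsLogQuadratic (coneAtInfinity δ) (1 / (2 * τ)) fun s => barnesG (c - s) τ := fun c => by
    simpa [sub_eq_add_neg] using isLogQuadratic_barnesG hτ hδ c (-1) (Or.inr rfl)
  have hplus : ∀ c : ℂ,
      IsLogQuadratic (coneAtInfinity δ) (1 / (2 * τ)) fun s => barnesG (c + s) τ := fun c => by
    simpa using isLogQuadratic_barnesG hτ hδ c 1 (Or.inl rfl)
  have hlt : ∀ {N k : ℕ}, k ≤ N → (Finset.univ.filter fun j : Fin N => (j : ℕ) < k).card = k :=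
    fun h => by rw [Fin.card_filter_val_lt, min_eq_right h]
  have hge : ∀ {N k : ℕ}, k ≤ N →
      (Finset.univ.filter fun j : Fin N => k ≤ (j : ℕ)).card = N - k := fun {N k} h => by
    have := Finset.card_filter_add_card_filter_not (s := Finset.univ)
      (fun j : Fin N => (j : ℕ) < k)
    simp only [not_lt, hlt h, Finset.card_univ, Fintype.card_fin] at this
    lia
  have key := ((IsLogQuadratic.prod_ite Finset.univ (fun j : Fin q => (j : ℕ) < m)
      fun j => hminus (b j)).mul
    (IsLogQuadratic.prod_ite Finset.univ (fun j : Fin p => (j : ℕ) < n)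
      fun j => hplus (1 + τ - a j))).div
    ((IsLogQuadratic.prod_ite Finset.univ (fun j : Fin q => m ≤ (j : ℕ))
      fun j => hplus (1 + τ - b j)).mul
    (IsLogQuadratic.prod_ite Finset.univ (fun j : Fin p => n ≤ (j : ℕ))
      fun j => hminus (a j)))
  rw [hlt hm, hlt hn, hge hm, hge hn] at key
  change IsLogQuadratic _ _ (fun s => calG m n a b s τ) at key
  convert key using 1
  rw [paramN, Nat.cast_sub hm, Nat.cast_sub hn]
  push_cast
  ring

lemma sin_le_sin_of_mem_sector {ε θ : ℝ} (hε : 0 < ε) (h1 : ε ≤ θ) (h2 : θ ≤ Real.pi - ε) :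
    Real.sin ε ≤ Real.sin θ := by
  rcases le_total θ (Real.pi / 2) with h | h
  · exact Real.sin_le_sin_of_le_of_le_pi_div_two (by linarith [Real.pi_pos]) h h1
  · rw [← Real.sin_pi_sub θ]
    exact Real.sin_le_sin_of_le_of_le_pi_div_two (by linarith [Real.pi_pos]) (by linarith)
      (by linarith)

lemma sin_mul_norm_le_abs_im {ε : ℝ} (hε : 0 < ε) {s : ℂ} (hs : s ∈ Splus ε ∪ Sminus ε) :
    Real.sin ε * ‖s‖ ≤ |s.im| := by
  have h : Real.sin ε ≤ |Real.sin s.arg| := by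
    rcases hs with ⟨-, h1, h2⟩ | ⟨-, h1, h2⟩
    · exact (sin_le_sin_of_mem_sector hε h1 h2).trans (le_abs_self _)
    · rw [← abs_neg, ← Real.sin_neg]
      exact (sin_le_sin_of_mem_sector hε h1 h2).trans (le_abs_self _)
  rw [← Complex.norm_mul_sin_arg s, abs_mul, abs_norm, mul_comm]
  gcongr

/-- Asymptotics of `𝒢^{m,n}_{p,q}(s)` in the sectors `S±_ε`, log-quadratic case `N ≠ 0`. -/
theorem calG_asymptotic_logquadratic (τ : ℝ) (hτ : 0 < τ) (ε : ℝ) (hε : ε ∈ Set.Ioo 0 Real.pi)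
    (m n : ℕ) {p q : ℕ} (hm : m ≤ q) (hn : n ≤ p) (hN : paramN m n p q ≠ 0)
    (a : Fin p → ℂ) (b : Fin q → ℂ) :
    ∃ R C : ℝ, 0 < R ∧ 0 < C ∧
      ∀ s ∈ Splus ε ∪ Sminus ε, R ≤ ‖s‖ →
        calG m n a b s (τ : ℂ) ≠ 0 ∧
        ∃ E : ℂ, ‖E‖ ≤ C * ‖s‖ ^ 2 ∧
          calG m n a b s (τ : ℂ) =
            Complex.exp ((paramN m n p q : ℂ) / (2 * (τ : ℂ)) * s ^ 2 * Complex.log s + E) := by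

  obtain ⟨E, hE, hG⟩ := isLogQuadratic_calG hτ (Real.sin_pos_of_mem_Ioo hε) hm hn a b
  obtain ⟨C, hC, hEC⟩ := hE.exists_pos
  obtain ⟨R, hR⟩ := eventually_coneAtInfinity.1 (hEC.bound.and hG)
  refine ⟨max R 1, C, by positivity, hC, fun s hs hRs => ?_⟩
  obtain ⟨h1, h2⟩ := hR s ((le_max_left _ _).trans hRs) (sin_mul_norm_le_abs_im hε.1 hs)
  refine ⟨?_, E s, by simpa only [norm_pow] using h1, h2⟩
  rw [show calG m n a b s τ = _ from h2]
  exact Complex.exp_ne_zero _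
end
end

section
/- Let τ > 0, ε ∈ (0, π), and let m ≤ q, n ≤ p be nonnegative integers with N := 2(m+n)−p−q = 0, a ∈ ℂ^p, b ∈ ℂ^q. Then there exist R, C > 0 such that for every s ∈ S⁺_ε ∪ S⁻_ε with |s| ≥ R, one has 𝒢^{m,n}_{p,q}(a;b|s;τ) ≠ 0 and 𝒢^{m,n}_{p,q}(a;b|s;τ) = exp( (π·i·χ(s)/(4τ))·(p−q)·s² − (μ/τ)·s·Log(s) + E(s) ) for some E(s) ∈ ℂ with |E(s)| ≤ C·|s|, where χ(s) := 1 if s ∈ S⁺_ε and χ(s) := −1 if s ∈ S⁻_ε. -/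
open Complex Filter MeasureTheory Set

noncomputable section

/-- The real linear form `z ↦ κ Re z + σ Im z`; for `κ > 0` its positivity set is an open half
plane containing the positive real axis and contained in the slit plane. -/
def tilt (κ σ : ℝ) (z : ℂ) : ℝ := κ * z.re + σ * z.im

theorem tilt_add (κ σ : ℝ) (z w : ℂ) : tilt κ σ (z + w) = tilt κ σ z + tilt κ σ w := by
  simp [tilt]; ring

theorem tilt_ofReal (κ σ x : ℝ) : tilt κ σ (x : ℂ) = κ * x := by
  simp [tilt]

theorem tilt_zero (κ σ : ℝ) : tilt κ σ 0 = 0 := by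
  simp [tilt]

theorem continuous_tilt (κ σ : ℝ) : Continuous (tilt κ σ) := by
  unfold tilt; fun_prop

theorem abs_tilt_le {κ σ : ℝ} (hκ : |κ| ≤ 1) (hσ : |σ| ≤ 1) (z : ℂ) :
    |tilt κ σ z| ≤ 2 * ‖z‖ := by
  have h1 := Complex.abs_re_le_norm z
  have h2 := Complex.abs_im_le_norm z
  calc |tilt κ σ z| ≤ |κ * z.re| + |σ * z.im| := abs_add_le _ _
    _ = |κ| * |z.re| + |σ| * |z.im| := by rw [abs_mul, abs_mul]
    _ ≤ 1 * ‖z‖ + 1 * ‖z‖ := by gcongr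
    _ = 2 * ‖z‖ := by ring

theorem tilt_le {κ σ : ℝ} (hκ : |κ| ≤ 1) (hσ : |σ| ≤ 1) (z : ℂ) : tilt κ σ z ≤ 2 * ‖z‖ :=
  (le_abs_self _).trans (abs_tilt_le hκ hσ z)

theorem convex_tilt_gt (κ σ c : ℝ) : Convex ℝ {z | c < tilt κ σ z} := by
  apply convex_halfSpace_gt
  constructor
  · exact tilt_add κ σ
  · intro r z; simp [tilt]; ring

theorem convex_tilt_ge (κ σ c : ℝ) : Convex ℝ {z | c ≤ tilt κ σ z} := by
  apply convex_halfSpace_ge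
  constructor
  · exact tilt_add κ σ
  · intro r z; simp [tilt]; ring

theorem mem_slitPlane_of_tilt_pos {κ σ : ℝ} (hκ : 0 < κ) {z : ℂ} (hz : 0 < tilt κ σ z) :
    z ∈ slitPlane := by
  rw [Complex.mem_slitPlane_iff]
  by_contra! h
  unfold tilt at hz
  rw [h.2] at hz
  nlinarith [h.1]

/-- The lattice point `mτ + n`. -/
def latt (τ : ℝ) (k : ℕ × ℕ) : ℝ := k.1 * τ + k.2

theorem latt_nonneg {τ : ℝ} (hτ : 0 < τ) (k : ℕ × ℕ) : 0 ≤ latt τ k := by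
  unfold latt; positivity

theorem min_le_latt {τ : ℝ} (hτ : 0 < τ) {k : ℕ × ℕ} (hk : k ≠ 0) : min 1 τ ≤ latt τ k := by
  obtain ⟨m, n⟩ := k
  unfold latt
  rcases Nat.eq_zero_or_pos m with rfl | hm
  · have hn : 1 ≤ n := Nat.one_le_iff_ne_zero.2 fun h => hk (by simp [h])
    have : (1 : ℝ) ≤ n := by exact_mod_cast hn
    simpa using Or.inl this
  · have : (1 : ℝ) ≤ m := by exact_mod_cast hm
    refine (min_le_right _ _).trans ?_
    have := Nat.cast_nonneg (α := ℝ) n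
    simp only
    nlinarith

theorem summable_one_add_mul_rpow {κ : ℝ} (hκ : 0 < κ) :
    Summable fun n : ℕ => (1 + κ * n) ^ (-(5 / 4) : ℝ) := by
  have h := (Real.summable_one_div_nat_add_rpow (1 / κ) (5 / 4)).2 (by norm_num)
  refine (h.mul_left (κ ^ (-(5 / 4) : ℝ))).congr fun n => ?_
  have h1 : 0 < (n : ℝ) + 1 / κ := by positivity
  rw [abs_of_pos h1, one_div, ← Real.rpow_neg h1.le, ← Real.mul_rpow hκ.le h1.le]
  congr 1
  field_simp
  ring

theorem summable_one_add_latt_rpow {τ κ : ℝ} (hτ : 0 < τ) (hκ : 0 < κ) :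
    Summable fun k : ℕ × ℕ => (1 + κ * latt τ k) ^ (-(5 / 2) : ℝ) := by
  have h1 := summable_one_add_mul_rpow (mul_pos hκ hτ)
  have h2 := summable_one_add_mul_rpow hκ
  have h := h1.mul_of_nonneg h2 (fun n => by positivity) (fun n => by positivity)
  refine h.of_nonneg_of_le (fun k => ?_) (fun k => ?_)
  · have := latt_nonneg hτ k
    positivity
  · have h0 := latt_nonneg hτ k
    rw [← Real.mul_rpow (by positivity) (by positivity),
      show (-(5 / 2) : ℝ) = 2 * (-(5 / 4)) by norm_num, Real.rpow_mul (by positivity)]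
    refine Real.rpow_le_rpow_of_nonpos (by positivity) ?_ (by norm_num)
    unfold latt
    norm_cast
    have : 0 ≤ κ * τ * k.1 := by positivity
    have : 0 ≤ κ * k.2 := by positivity
    have : 0 ≤ (κ * τ * k.1) * (κ * k.2) := by positivity
    nlinarith [sq_nonneg (κ * τ * k.1), sq_nonneg (κ * k.2)]

theorem summable_latt_inv_cube {τ : ℝ} (hτ : 0 < τ) :
    Summable fun k : ℕ × ℕ => (latt τ k)⁻¹ ^ 3 := by
  have h := summable_one_add_latt_rpow hτ one_pos
  set c := min 1 τ with hc
  have hc0 : 0 < c := lt_min one_pos hτ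
  refine (h.mul_left (((1 + c) / c) ^ 3)).of_nonneg_of_le (fun k => ?_) (fun k => ?_)
  · have := latt_nonneg hτ k
    positivity
  · have h0 := latt_nonneg hτ k
    by_cases hk : k = 0
    · subst hk
      simp only [latt, Prod.fst_zero, Prod.snd_zero, Nat.cast_zero, zero_mul, add_zero, inv_zero,
        zero_pow three_ne_zero]
      positivity
    · have hl := min_le_latt hτ hk
      rw [← hc] at hl
      have hl0 : 0 < latt τ k := hc0.trans_le hl
      have h1 : (latt τ k)⁻¹ ≤ (1 + c) / c * (1 + latt τ k)⁻¹ := by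
        rw [← div_eq_mul_inv, div_div, inv_eq_one_div, div_le_div_iff₀ hl0 (by positivity)]
        nlinarith
      calc (latt τ k)⁻¹ ^ 3 ≤ ((1 + c) / c * (1 + latt τ k)⁻¹) ^ 3 := by gcongr
        _ = ((1 + c) / c) ^ 3 * (1 + latt τ k) ^ (-3 : ℝ) := by
          rw [mul_pow, Real.rpow_neg (by positivity), inv_pow]; norm_cast
        _ ≤ _ := by
          rw [one_mul]
          gcongr
          · linarith
          · norm_num

theorem latt_le_norm_add {τ κ σ : ℝ} (hτ : 0 < τ) (hκ : 0 < κ) (hκ1 : κ ≤ 1) (hσ : |σ| ≤ 1)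
    {z : ℂ} (hz : -(κ * min 1 τ / 2) < tilt κ σ z) {k : ℕ × ℕ} (hk : k ≠ (0, 0)) :
    0 < tilt κ σ (z + latt τ k) ∧ κ * latt τ k / 4 ≤ ‖z + latt τ k‖ := by
  have hl := min_le_latt hτ hk
  have hc0 : 0 < min 1 τ := lt_min one_pos hτ
  have h1 : κ * latt τ k / 2 < tilt κ σ (z + latt τ k) := by
    rw [tilt_add, tilt_ofReal]
    nlinarith
  have h2 := tilt_le (by rwa [abs_of_pos hκ]) hσ (z + latt τ k)
  have : 0 < κ * latt τ k := mul_pos hκ (hc0.trans_le hl)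
  constructor <;> linarith

/-- The logarithm of the `k`-th factor of the Weierstrass product of the double gamma function. -/
def logFactor (τ : ℝ) (k : ℕ × ℕ) (z : ℂ) : ℂ :=
  if k = (0, 0) then 0 else
    Complex.log (1 + z / latt τ k) - z / latt τ k + z ^ 2 / (2 * (latt τ k : ℂ) ^ 2)

/-- First derivative of `logFactor`. -/
def logFactor₁ (τ : ℝ) (k : ℕ × ℕ) (z : ℂ) : ℂ :=
  if k = (0, 0) then 0 else z ^ 2 / ((latt τ k : ℂ) ^ 2 * (z + latt τ k))

/-- Second derivative of `logFactor`. -/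
def logFactor₂ (τ : ℝ) (k : ℕ × ℕ) (z : ℂ) : ℂ :=
  if k = (0, 0) then 0 else
    z * (z + 2 * latt τ k) / ((latt τ k : ℂ) ^ 2 * (z + latt τ k) ^ 2)

/-- Third derivative of `logFactor`. -/
def logFactor₃ (τ : ℝ) (k : ℕ × ℕ) (z : ℂ) : ℂ :=
  if k = (0, 0) then 0 else 2 / (z + latt τ k) ^ 3

theorem hasDerivAt_logFactor {τ κ σ : ℝ} (hτ : 0 < τ) (hκ : 0 < κ) (hκ1 : κ ≤ 1) (hσ : |σ| ≤ 1)
    {z : ℂ} (hz : -(κ * min 1 τ / 2) < tilt κ σ z) (k : ℕ × ℕ) :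
    HasDerivAt (logFactor τ k) (logFactor₁ τ k z) z ∧
    HasDerivAt (logFactor₁ τ k) (logFactor₂ τ k z) z ∧
    HasDerivAt (logFactor₂ τ k) (logFactor₃ τ k z) z := by
  by_cases hk : k = (0, 0)
  · unfold logFactor logFactor₁ logFactor₂ logFactor₃
    simp only [hk, if_true]
    exact ⟨hasDerivAt_const _ _, hasDerivAt_const _ _, hasDerivAt_const _ _⟩
  unfold logFactor logFactor₁ logFactor₂ logFactor₃
  simp only [hk, if_false]
  obtain ⟨h1, h2⟩ := latt_le_norm_add hτ hκ hκ1 hσ hz hk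
  have hl0 : 0 < latt τ k := (lt_min one_pos hτ).trans_le (min_le_latt hτ hk)
  set l := latt τ k
  have hl : (l : ℂ) ≠ 0 := by exact_mod_cast hl0.ne'
  have hzl : z + l ≠ 0 := by
    rw [← norm_pos_iff]
    have : 0 < κ * l := mul_pos hκ hl0
    linarith
  have hlz : 1 + z / l = ((l⁻¹ : ℝ) : ℂ) * (z + l) := by
    push_cast; field_simp; ring
  have hs : 1 + z / l ∈ slitPlane := by
    apply mem_slitPlane_of_tilt_pos (σ := σ) hκ
    rw [hlz]
    have : tilt κ σ (((l⁻¹ : ℝ) : ℂ) * (z + l)) = l⁻¹ * tilt κ σ (z + l) := by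
      simp only [tilt, Complex.re_ofReal_mul, Complex.im_ofReal_mul]; ring
    rw [this]; positivity
  have hid := hasDerivAt_id z
  refine ⟨?_, ?_, ?_⟩
  · have := ((((hid.div_const (l : ℂ)).const_add 1).clog hs).sub (hid.div_const (l : ℂ))).add
      ((hid.pow 2).div_const (2 * (l : ℂ) ^ 2))
    refine this.congr_deriv ?_
    have : 1 + id z / (l : ℂ) ≠ 0 := slitPlane_ne_zero hs
    simp only [id] at *
    rw [hlz]
    push_cast
    field_simp
    ring
  · have := (hid.pow 2).div ((hid.add_const (l : ℂ)).const_mul ((l : ℂ) ^ 2))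
      (by simp [hl, hzl])
    refine this.congr_deriv ?_
    simp only [id]
    simp
    field_simp
    ring
  · have := (hid.mul (hid.add_const (2 * (l : ℂ)))).div
      (((hid.add_const (l : ℂ)).pow 2).const_mul ((l : ℂ) ^ 2))
      (by simp [hl, hzl])
    refine this.congr_deriv ?_
    simp only [id]
    simp
    field_simp
    ring

theorem norm_logFactor_deriv_le {τ κ σ : ℝ} (hτ : 0 < τ) (hκ : 0 < κ) (hκ1 : κ ≤ 1)
    (hσ : |σ| ≤ 1) {R : ℝ} (hR : 0 ≤ R) :
    ∃ C : ℝ, ∀ z : ℂ, ‖z‖ ≤ R → -(κ * min 1 τ / 2) < tilt κ σ z → ∀ k,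
      ‖logFactor₁ τ k z‖ ≤ C * (latt τ k)⁻¹ ^ 3 ∧
      ‖logFactor₂ τ k z‖ ≤ C * (latt τ k)⁻¹ ^ 3 ∧
      ‖logFactor₃ τ k z‖ ≤ C * (latt τ k)⁻¹ ^ 3 := by
  have hc0 : 0 < min 1 τ := lt_min one_pos hτ
  set c := min 1 τ with hc
  have e1 : 0 ≤ R ^ 2 * (4 / κ) := by positivity
  have e2 : 0 ≤ R * (R / c + 2) * (4 / κ) ^ 2 := by positivity
  have e3 : 0 ≤ 2 * (4 / κ) ^ 3 := by positivity
  refine ⟨R ^ 2 * (4 / κ) + R * (R / c + 2) * (4 / κ) ^ 2 + 2 * (4 / κ) ^ 3,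
    fun z hzR hz k => ?_⟩
  have hll := latt_nonneg hτ k
  by_cases hk : k = (0, 0)
  · unfold logFactor₁ logFactor₂ logFactor₃
    simp only [hk, if_true, norm_zero]
    rw [hk] at hll
    have : 0 ≤ (R ^ 2 * (4 / κ) + R * (R / c + 2) * (4 / κ) ^ 2 + 2 * (4 / κ) ^ 3) *
      (latt τ (0, 0))⁻¹ ^ 3 := by positivity
    exact ⟨this, this, this⟩
  unfold logFactor₁ logFactor₂ logFactor₃
  simp only [hk, if_false]
  obtain ⟨h1, h2⟩ := latt_le_norm_add hτ hκ hκ1 hσ hz hk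
  have hcl := min_le_latt hτ hk
  have hl0 : 0 < latt τ k := hc0.trans_le hcl
  set l := latt τ k
  have hpos : 0 < ‖z + l‖ := by
    have : 0 < κ * l := mul_pos hκ hl0
    linarith
  have hinv : ‖z + l‖⁻¹ ≤ 4 / κ * l⁻¹ := by
    rw [← div_eq_mul_inv, div_div, inv_eq_one_div, div_le_div_iff₀ (by positivity) (by positivity)]
    linarith
  have hnl : ‖(l : ℂ)‖ = l := by simp [abs_of_pos hl0]
  have hil : 0 ≤ l⁻¹ ^ 3 := by positivity
  refine ⟨?_, ?_, ?_⟩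
  · rw [norm_div, norm_mul, norm_pow, norm_pow, hnl]
    calc ‖z‖ ^ 2 / (l ^ 2 * ‖z + l‖) = ‖z‖ ^ 2 * l⁻¹ ^ 2 * ‖z + l‖⁻¹ := by
          rw [div_eq_mul_inv, mul_inv, inv_pow]; ring
      _ ≤ R ^ 2 * l⁻¹ ^ 2 * (4 / κ * l⁻¹) := by gcongr
      _ = (R ^ 2 * (4 / κ)) * l⁻¹ ^ 3 := by ring
      _ ≤ _ := by gcongr; linarith
  · have h3 : ‖z + 2 * l‖ ≤ (R / c + 2) * l := by
      have : ‖(2 * l : ℂ)‖ = 2 * l := by rw [norm_mul, hnl]; simp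
      have h4 := norm_add_le z (2 * l)
      have h5 : R ≤ R / c * l := by
        rw [div_mul_eq_mul_div, le_div_iff₀ hc0]; gcongr
      linarith
    rw [norm_div, norm_mul, norm_mul, norm_pow, norm_pow, hnl]
    calc ‖z‖ * ‖z + 2 * l‖ / (l ^ 2 * ‖z + l‖ ^ 2)
        = ‖z‖ * ‖z + 2 * l‖ * l⁻¹ ^ 2 * ‖z + l‖⁻¹ ^ 2 := by
          rw [div_eq_mul_inv, mul_inv, inv_pow, inv_pow]; ring
      _ ≤ R * ((R / c + 2) * l) * l⁻¹ ^ 2 * (4 / κ * l⁻¹) ^ 2 := by gcongr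
      _ = (R * (R / c + 2) * (4 / κ) ^ 2) * l⁻¹ ^ 3 := by field_simp
      _ ≤ _ := by gcongr; linarith
  · rw [norm_div, norm_pow]
    calc ‖(2 : ℂ)‖ / ‖z + l‖ ^ 3 = 2 * ‖z + l‖⁻¹ ^ 3 := by
          rw [div_eq_mul_inv, inv_pow]; simp
      _ ≤ 2 * (4 / κ * l⁻¹) ^ 3 := by gcongr
      _ = (2 * (4 / κ) ^ 3) * l⁻¹ ^ 3 := by ring
      _ ≤ _ := by gcongr; linarith

theorem hasDerivAt_tsum_logFactor {τ κ σ : ℝ} (hτ : 0 < τ) (hκ : 0 < κ) (hκ1 : κ ≤ 1)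
    (hσ : |σ| ≤ 1) {z : ℂ} (hz : 0 < tilt κ σ z) :
    HasDerivAt (fun z => ∑' k, logFactor τ k z) (∑' k, logFactor₁ τ k z) z ∧
    HasDerivAt (fun z => ∑' k, logFactor₁ τ k z) (∑' k, logFactor₂ τ k z) z ∧
    HasDerivAt (fun z => ∑' k, logFactor₂ τ k z) (∑' k, logFactor₃ τ k z) z ∧
    Summable (fun k => logFactor τ k z) ∧ Summable (fun k => logFactor₃ τ k z) := by
  have hc0 : 0 < min 1 τ := lt_min one_pos hτ
  have hη : 0 < κ * min 1 τ / 2 := by positivity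
  set R := ‖z‖ + 1 with hR
  have hR0 : 0 < R := by positivity
  obtain ⟨C, hC⟩ := norm_logFactor_deriv_le hτ hκ hκ1 hσ hR0.le
  have hu := (summable_latt_inv_cube hτ).mul_left C
  set t : Set ℂ := Metric.ball 0 R ∩ {z | -(κ * min 1 τ / 2) < tilt κ σ z} with ht
  have hto : IsOpen t := Metric.isOpen_ball.inter
    (isOpen_lt continuous_const (continuous_tilt κ σ))
  have htc : IsPreconnected t := ((convex_ball 0 R).inter (convex_tilt_gt κ σ _)).isPreconnected
  have h0 : (0 : ℂ) ∈ t := ⟨by simpa using hR0, by simpa [tilt_zero] using hη⟩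
  have hzt : z ∈ t := ⟨by simp [hR], by simp only [mem_ofPred_eq]; linarith⟩
  have hb : ∀ y ∈ t, ‖y‖ ≤ R := fun y hy => by simpa using (Metric.mem_ball.1 hy.1).le
  have hs0 : Summable fun k => logFactor τ k 0 := by
    simp [logFactor, summable_zero]
  have hs1 : Summable fun k => logFactor₁ τ k 0 := by
    simp [logFactor₁, summable_zero]
  have hs2 : Summable fun k => logFactor₂ τ k 0 := by
    simp [logFactor₂, summable_zero]
  refine ⟨?_, ?_, ?_, ?_, ?_⟩
  · exact hasDerivAt_tsum_of_isPreconnected hu hto htc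
      (fun k y hy => (hasDerivAt_logFactor hτ hκ hκ1 hσ hy.2 k).1)
      (fun k y hy => (hC y (hb y hy) hy.2 k).1) h0 hs0 hzt
  · exact hasDerivAt_tsum_of_isPreconnected hu hto htc
      (fun k y hy => (hasDerivAt_logFactor hτ hκ hκ1 hσ hy.2 k).2.1)
      (fun k y hy => (hC y (hb y hy) hy.2 k).2.1) h0 hs1 hzt
  · exact hasDerivAt_tsum_of_isPreconnected hu hto htc
      (fun k y hy => (hasDerivAt_logFactor hτ hκ hκ1 hσ hy.2 k).2.2)
      (fun k y hy => (hC y (hb y hy) hy.2 k).2.2) h0 hs2 hzt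
  · exact summable_of_summable_hasDerivAt_of_isPreconnected hu hto htc
      (fun k y hy => (hasDerivAt_logFactor hτ hκ hκ1 hσ hy.2 k).1)
      (fun k y hy => (hC y (hb y hy) hy.2 k).1) h0 hs0 hzt
  · exact hu.of_norm_bounded (fun k => (hC z (hb z hzt) hzt.2 k).2.2)

theorem barnesG_eq_exp {τ κ σ : ℝ} (hτ : 0 < τ) (hκ : 0 < κ) (hκ1 : κ ≤ 1)
    (hσ : |σ| ≤ 1) {z : ℂ} (hz : 0 < tilt κ σ z) :
    barnesG z τ = Complex.exp (∑' k, logFactor τ k z + Complex.log (z / τ) +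
      (aBarnes τ * z / τ + bBarnes τ * z ^ 2 / (2 * τ))) := by
  obtain ⟨-, -, -, hs, -⟩ := hasDerivAt_tsum_logFactor hτ hκ hκ1 hσ hz
  have hz0 : z ≠ 0 := by rintro rfl; simp [tilt_zero] at hz
  have hτ0 : (τ : ℂ) ≠ 0 := by exact_mod_cast hτ.ne'
  have hη : 0 < κ * min 1 τ / 2 := by
    have : 0 < min 1 τ := lt_min one_pos hτ
    positivity
  rw [Complex.exp_add, Complex.exp_add, Complex.exp_log (div_ne_zero hz0 hτ0),
    ← hs.hasSum.cexp.tprod_eq]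
  unfold barnesG
  have : ∀ mn : ℕ × ℕ, (if mn = (0, 0) then 1
      else (1 + z / (mn.1 * τ + mn.2)) *
        Complex.exp (-(z / (mn.1 * τ + mn.2)) +
          z ^ 2 / (2 * ((mn.1 : ℂ) * τ + (mn.2 : ℂ)) ^ 2))) =
      (Complex.exp ∘ fun k => logFactor τ k z) mn := by
    intro k
    simp only [Function.comp, logFactor]
    split_ifs with hk
    · simp
    · obtain ⟨h1, h2⟩ := latt_le_norm_add hτ hκ hκ1 hσ (z := z) (by linarith) hk
      have hl0 : 0 < latt τ k := (lt_min one_pos hτ).trans_le (min_le_latt hτ hk)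
      have hl : (latt τ k : ℂ) ≠ 0 := by exact_mod_cast hl0.ne'
      have hzl : z + latt τ k ≠ 0 := by
        rw [← norm_pos_iff]
        have : 0 < κ * latt τ k := mul_pos hκ hl0
        linarith
      have hne : 1 + z / latt τ k ≠ 0 := by
        rw [one_add_div hl, add_comm]
        exact div_ne_zero hzl hl
      have hcast : (k.1 : ℂ) * τ + k.2 = latt τ k := by simp [latt]
      rw [hcast, sub_add, sub_eq_add_neg (Complex.log _),
        Complex.exp_add (Complex.log _), Complex.exp_log hne]
      congr 2
      ring
  rw [tprod_congr this]
  ring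

/-- The function whose mixed difference with steps `1` and `τ` is `2 / w ^ 3 + O(w⁻⁵)`. -/
def cubeSum (τ : ℝ) (w : ℂ) : ℂ := 1 / (τ * w) + (1 + τ) / (2 * τ * w ^ 2)

/-- The mixed difference with steps `1` and `τ` of `cubeSum`. -/
def cubeSumDiff (τ : ℝ) (w : ℂ) : ℂ :=
  cubeSum τ w - cubeSum τ (w + τ) - (cubeSum τ (w + 1) - cubeSum τ (w + 1 + τ))

theorem cubeSum_expand {τ : ℝ} (hτ : 0 < τ) {w : ℂ} (hw : w ≠ 0) {a : ℂ} (ha : w + a ≠ 0) :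
    cubeSum τ (w + a) = 1 / τ * (1 / w - a / w ^ 2 + a ^ 2 / w ^ 3 - a ^ 3 / w ^ 4) +
      (1 + τ) / (2 * τ) * (1 / w ^ 2 - 2 * a / w ^ 3 + 3 * a ^ 2 / w ^ 4) +
      (1 / τ * (a ^ 4 / (w ^ 4 * (w + a))) -
        (1 + τ) / (2 * τ) * (a ^ 3 * (w + 3 * (w + a)) / (w ^ 4 * (w + a) ^ 2))) := by
  have hτ0 : (τ : ℂ) ≠ 0 := by exact_mod_cast hτ.ne'
  unfold cubeSum
  field_simp
  ring

theorem norm_le_mul_norm_add_of_tilt_pos {κ σ : ℝ} (hκ : 0 < κ) (hκ1 : κ ≤ 1) (hσ : |σ| ≤ 1) {w : ℂ}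
    (hw : 0 < tilt κ σ w) {a : ℝ} (ha : 0 ≤ a) : ‖w‖ ≤ (1 + 2 / κ) * ‖w + a‖ := by
  have h1 : ‖w‖ ≤ ‖w + a‖ + a := by
    have := norm_sub_le (w + a) (a : ℂ)
    rwa [add_sub_cancel_right, Complex.norm_real, Real.norm_of_nonneg ha] at this
  have h2 := tilt_le (by rwa [abs_of_pos hκ]) hσ (w + a)
  rw [tilt_add, tilt_ofReal] at h2
  have h3 : a ≤ 2 / κ * ‖w + a‖ := by
    rw [div_mul_eq_mul_div, le_div_iff₀ hκ]; linarith
  linarith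

theorem norm_cubeSum_remainder_le {τ κ σ : ℝ} (hτ : 0 < τ) (hκ : 0 < κ) (hκ1 : κ ≤ 1)
    (hσ : |σ| ≤ 1) {a : ℝ} (ha : 0 ≤ a) :
    ∃ C : ℝ, 0 ≤ C ∧ ∀ w : ℂ, 0 < tilt κ σ w →
      ‖1 / τ * ((a : ℂ) ^ 4 / (w ^ 4 * (w + a))) -
        (1 + τ) / (2 * τ) * (a ^ 3 * (w + 3 * (w + a)) / (w ^ 4 * (w + a) ^ 2))‖ ≤
        C * ‖w‖⁻¹ ^ 5 := by
  set K := 1 + 2 / κ with hK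
  have hK0 : 0 < K := by positivity
  refine ⟨1 / τ * (a ^ 4 * K) + (1 + τ) / (2 * τ) * (a ^ 3 * (K ^ 2 + 3 * K)), by positivity,
    fun w hw => ?_⟩
  have hw0 : 0 < ‖w‖ := by
    rw [norm_pos_iff]; rintro rfl; simp [tilt_zero] at hw
  have h1 := norm_le_mul_norm_add_of_tilt_pos hκ hκ1 hσ hw ha
  rw [← hK] at h1
  have hwa : 0 < ‖w + a‖ := by
    by_contra! h
    nlinarith
  have hinv : ‖w + a‖⁻¹ ≤ K * ‖w‖⁻¹ := by
    rw [← div_eq_mul_inv, inv_eq_one_div, div_le_div_iff₀ hwa hw0]; linarith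
  have hnτ : ‖(τ : ℂ)‖ = τ := by simp [abs_of_pos hτ]
  have hna : ‖(a : ℂ)‖ = a := by simp [abs_of_nonneg ha]
  have hn1 : ‖(1 + τ : ℂ)‖ = 1 + τ := by
    rw [← Complex.ofReal_one, ← Complex.ofReal_add, Complex.norm_real,
      Real.norm_of_nonneg (by positivity)]
  refine (norm_sub_le _ _).trans ?_
  rw [add_mul]
  gcongr
  · rw [norm_mul, norm_div, norm_div, norm_mul, norm_pow, norm_pow, hnτ, hna, norm_one, mul_assoc]
    gcongr
    calc a ^ 4 / (‖w‖ ^ 4 * ‖w + a‖) = a ^ 4 * ‖w‖⁻¹ ^ 4 * ‖w + a‖⁻¹ := by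
          rw [div_eq_mul_inv, mul_inv, inv_pow]; ring
      _ ≤ a ^ 4 * ‖w‖⁻¹ ^ 4 * (K * ‖w‖⁻¹) := by gcongr
      _ = _ := by ring
  · rw [norm_mul, norm_div, norm_div, norm_mul, norm_mul, norm_mul, norm_pow, norm_pow, norm_pow,
      hnτ, hna, hn1, mul_assoc, Complex.norm_ofNat]
    gcongr
    have h2 : ‖w + 3 * (w + a)‖ ≤ ‖w‖ + 3 * ‖w + a‖ := by
      refine (norm_add_le _ _).trans ?_
      rw [norm_mul, Complex.norm_ofNat]
    calc a ^ 3 * ‖w + 3 * (w + a)‖ / (‖w‖ ^ 4 * ‖w + a‖ ^ 2)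
        ≤ a ^ 3 * (‖w‖ + 3 * ‖w + a‖) / (‖w‖ ^ 4 * ‖w + a‖ ^ 2) := by gcongr
      _ = a ^ 3 * ‖w‖⁻¹ ^ 4 * (‖w‖ * ‖w + a‖⁻¹ ^ 2 + 3 * ‖w + a‖⁻¹) := by field_simp
      _ ≤ a ^ 3 * ‖w‖⁻¹ ^ 4 * (‖w‖ * (K * ‖w‖⁻¹) ^ 2 + 3 * (K * ‖w‖⁻¹)) := by gcongr
      _ = _ := by field_simp

theorem norm_cubeSumDiff_sub_le {τ κ σ : ℝ} (hτ : 0 < τ) (hκ : 0 < κ) (hκ1 : κ ≤ 1)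
    (hσ : |σ| ≤ 1) :
    ∃ C : ℝ, 0 ≤ C ∧ ∀ w : ℂ, 0 < tilt κ σ w →
      ‖2 / w ^ 3 - cubeSumDiff τ w‖ ≤ C * ‖w‖⁻¹ ^ 5 := by
  obtain ⟨C₁, h₁, hC₁⟩ := norm_cubeSum_remainder_le hτ hκ hκ1 hσ zero_le_one
  obtain ⟨C₂, h₂, hC₂⟩ := norm_cubeSum_remainder_le hτ hκ hκ1 hσ hτ.le
  obtain ⟨C₃, h₃, hC₃⟩ := norm_cubeSum_remainder_le hτ hκ hκ1 hσ (add_nonneg zero_le_one hτ.le)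
  refine ⟨C₁ + C₂ + C₃, by positivity, fun w hw => ?_⟩
  have hτ0 : (τ : ℂ) ≠ 0 := by exact_mod_cast hτ.ne'
  have hne : ∀ a : ℝ, 0 ≤ a → w + a ≠ 0 := fun a ha h => by
    have h' : tilt κ σ (w + a) = 0 := by rw [h, tilt_zero]
    rw [tilt_add, tilt_ofReal] at h'
    have := mul_nonneg hκ.le ha
    linarith
  have hw0 : w ≠ 0 := by simpa using hne 0 le_rfl
  have e₁ := cubeSum_expand hτ hw0 (hne 1 zero_le_one)
  have e₂ := cubeSum_expand hτ hw0 (hne τ hτ.le)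
  have e₃ := cubeSum_expand hτ hw0 (hne (1 + τ) (add_nonneg zero_le_one hτ.le))
  have b₁ := hC₁ w hw
  have b₂ := hC₂ w hw
  have b₃ := hC₃ w hw
  generalize (1 / τ * (((1 : ℝ) : ℂ) ^ 4 / (w ^ 4 * (w + (1 : ℝ)))) -
        (1 + τ) / (2 * τ) * (((1 : ℝ) : ℂ) ^ 3 * (w + 3 * (w + (1 : ℝ))) /
          (w ^ 4 * (w + (1 : ℝ)) ^ 2))) = r₁ at e₁ b₁
  generalize (1 / τ * ((τ : ℂ) ^ 4 / (w ^ 4 * (w + τ))) -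
        (1 + τ) / (2 * τ) * ((τ : ℂ) ^ 3 * (w + 3 * (w + τ)) /
          (w ^ 4 * (w + τ) ^ 2))) = r₂ at e₂ b₂
  generalize (1 / τ * (((1 + τ : ℝ) : ℂ) ^ 4 / (w ^ 4 * (w + (1 + τ : ℝ)))) -
        (1 + τ) / (2 * τ) * (((1 + τ : ℝ) : ℂ) ^ 3 * (w + 3 * (w + (1 + τ : ℝ))) /
          (w ^ 4 * (w + (1 + τ : ℝ)) ^ 2))) = r₃ at e₃ b₃
  have key : 2 / w ^ 3 - cubeSumDiff τ w = r₁ + r₂ - r₃ := by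
    have ha : w + 1 + τ = w + ((1 + τ : ℝ) : ℂ) := by push_cast; ring
    have hb : w + 1 = w + ((1 : ℝ) : ℂ) := by push_cast; ring
    unfold cubeSumDiff
    rw [ha, hb, e₁, e₂, e₃]
    unfold cubeSum
    push_cast
    field_simp
    ring
  rw [key]
  calc ‖r₁ + r₂ - r₃‖ ≤ ‖r₁‖ + ‖r₂‖ + ‖r₃‖ :=
        (norm_sub_le _ _).trans (by gcongr; exact norm_add_le _ _)
    _ ≤ _ := by rw [add_mul, add_mul]; gcongr

theorem tendsto_cubeSum_add_mul {τ : ℝ} (hτ : 0 < τ) (z : ℂ) {a : ℝ} (ha : 0 < a) :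
    Tendsto (fun n : ℕ => cubeSum τ (z + n * a)) atTop (nhds 0) := by
  have hτ0 : (τ : ℂ) ≠ 0 := by exact_mod_cast hτ.ne'
  have ha0 : (a : ℂ) ≠ 0 := by exact_mod_cast ha.ne'
  have h1 : Tendsto (fun n : ℕ => z + n * (a : ℂ)) atTop (Bornology.cobounded ℂ) := by
    have h2 : Tendsto (fun n : ℕ => (n : ℂ) * (a : ℂ)) atTop (Bornology.cobounded ℂ) := by
      rw [← tendsto_norm_atTop_iff_cobounded]
      simp only [norm_mul, Complex.norm_natCast]
      exact tendsto_natCast_atTop_atTop.atTop_mul_const (norm_pos_iff.2 ha0)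
    exact tendsto_const_add_cobounded z |>.comp h2
  have h2 := tendsto_inv₀_cobounded.comp h1
  have h3 := (h2.const_mul (1 / (τ : ℂ))).add ((h2.pow 2).const_mul ((1 + τ) / (2 * (τ : ℂ))))
  simp only [mul_zero, ne_eq, OfNat.ofNat_ne_zero, not_false_eq_true, zero_pow, add_zero] at h3
  refine h3.congr fun n => ?_
  simp only [Function.comp, cubeSum]
  simp only [div_eq_mul_inv, mul_inv, inv_pow]
  ring

theorem tsum_sub_succ_of_tendsto_zero {f : ℕ → ℂ} (hs : Summable fun n => f n - f (n + 1))
    (hf : Tendsto f atTop (nhds 0)) : ∑' n, (f n - f (n + 1)) = f 0 := by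
  have h1 := hs.hasSum.tendsto_sum_nat
  simp only [Finset.sum_range_sub'] at h1
  have h2 := hf.const_sub (f 0)
  rw [sub_zero] at h2
  exact tendsto_nhds_unique h1 h2

theorem tsum_cubeSumDiff {τ : ℝ} (hτ : 0 < τ) (z : ℂ)
    (hs : Summable fun k => cubeSumDiff τ (z + latt τ k)) :
    ∑' k, cubeSumDiff τ (z + latt τ k) = cubeSum τ z := by
  have hin : ∀ m : ℕ, ∑' n : ℕ, cubeSumDiff τ (z + latt τ (m, n)) =
      cubeSum τ (z + m * τ) - cubeSum τ (z + (m + 1 : ℕ) * τ) := by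
    intro m
    set f : ℕ → ℂ := fun n =>
      cubeSum τ (z + m * τ + n * (1 : ℝ)) - cubeSum τ (z + (m + 1 : ℕ) * τ + n * (1 : ℝ)) with hf
    have hfd : ∀ n : ℕ, cubeSumDiff τ (z + latt τ (m, n)) = f n - f (n + 1) := by
      intro n
      simp only [hf, cubeSumDiff, latt]
      push_cast
      ring_nf
    have hft : Tendsto f atTop (nhds 0) := by
      have := (tendsto_cubeSum_add_mul hτ (z + m * τ) one_pos).sub
        (tendsto_cubeSum_add_mul hτ (z + (m + 1 : ℕ) * τ) one_pos)
      rwa [sub_zero] at this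
    have hsm := hs.prod_factor m
    simp only [hfd] at hsm ⊢
    rw [tsum_sub_succ_of_tendsto_zero hsm hft]
    simp [hf]
  have hout := hs.prod
  rw [hs.tsum_prod]
  simp only [hin] at hout ⊢
  rw [tsum_sub_succ_of_tendsto_zero (f := fun m : ℕ => cubeSum τ (z + m * τ)) hout
    (tendsto_cubeSum_add_mul hτ z hτ)]
  simp

theorem norm_tsum_logFactor₃_sub_le {τ κ σ : ℝ} (hτ : 0 < τ) (hκ : 0 < κ) (hκ1 : κ ≤ 1)
    (hσ : |σ| ≤ 1) :
    ∃ C : ℝ, 0 ≤ C ∧ ∀ z : ℂ, 1 ≤ tilt κ σ z →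
      ‖∑' k, logFactor₃ τ k z - cubeSum τ z‖ ≤ C * tilt κ σ z ^ (-(5 / 2) : ℝ) := by
  obtain ⟨C, hC0, hC⟩ := norm_cubeSumDiff_sub_le hτ hκ hκ1 hσ
  have hu := summable_one_add_latt_rpow hτ hκ
  set U := ∑' k : ℕ × ℕ, (1 + κ * latt τ k) ^ (-(5 / 2) : ℝ) with hU
  have hU0 : 0 ≤ U := tsum_nonneg fun k => by
    have := latt_nonneg hτ k
    positivity
  refine ⟨C * 32 * U + 16, by positivity, fun z hz => ?_⟩
  have hz0 : 0 < tilt κ σ z := by linarith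
  set x := tilt κ σ z with hx
  have hinv : ∀ k, ‖z + latt τ k‖⁻¹ ≤ 2 * (x + κ * latt τ k)⁻¹ := fun k => by
    have h1 := tilt_le (by rwa [abs_of_pos hκ]) hσ (z + latt τ k)
    rw [tilt_add, tilt_ofReal, ← hx] at h1
    have h2 := mul_nonneg hκ.le (latt_nonneg hτ k)
    rw [← div_eq_mul_inv, inv_eq_one_div, div_le_div_iff₀ (by linarith) (by linarith)]
    linarith
  have hterm : ∀ k, ‖2 / (z + latt τ k) ^ 3 - cubeSumDiff τ (z + latt τ k)‖ ≤
      C * 32 * x ^ (-(5 / 2) : ℝ) * (1 + κ * latt τ k) ^ (-(5 / 2) : ℝ) := fun k => by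
    have h2 := mul_nonneg hκ.le (latt_nonneg hτ k)
    have hp : 0 < tilt κ σ (z + latt τ k) := by rw [tilt_add, tilt_ofReal]; linarith
    set y := x + κ * latt τ k with hy
    have hy0 : 0 < y := by linarith
    have hsplit : y⁻¹ ^ 5 = y ^ (-(5 / 2) : ℝ) * y ^ (-(5 / 2) : ℝ) := by
      rw [← Real.rpow_add hy0, show (-(5 / 2) + -(5 / 2) : ℝ) = -5 by norm_num,
        Real.rpow_neg hy0.le, inv_pow]
      norm_cast
    calc _ ≤ C * ‖z + latt τ k‖⁻¹ ^ 5 := hC _ hp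
      _ ≤ C * (2 * y⁻¹) ^ 5 := by gcongr; exact hinv k
      _ = C * 32 * (y ^ (-(5 / 2) : ℝ) * y ^ (-(5 / 2) : ℝ)) := by rw [← hsplit]; ring
      _ ≤ C * 32 * (x ^ (-(5 / 2) : ℝ) * (1 + κ * latt τ k) ^ (-(5 / 2) : ℝ)) := by
        gcongr ?_ * (?_ * ?_)
        · exact Real.rpow_le_rpow_of_nonpos hz0 (by linarith) (by norm_num)
        · exact Real.rpow_le_rpow_of_nonpos (by linarith) (by linarith) (by norm_num)
      _ = _ := by ring
  have hsd := Summable.of_norm_bounded (hu.mul_left _) hterm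
  obtain ⟨-, -, -, -, hs3⟩ := hasDerivAt_tsum_logFactor hτ hκ hκ1 hσ hz0
  have hcube : (fun k => 2 / (z + latt τ k) ^ 3) =
      fun k => logFactor₃ τ k z + (if k = (0, 0) then 2 / z ^ 3 else 0) := by
    funext k
    unfold logFactor₃
    split_ifs with hk
    · simp [hk, latt]
    · simp
  have hsi : Summable fun k : ℕ × ℕ => (if k = (0, 0) then 2 / z ^ 3 else 0) :=
    (hasSum_ite_eq (0, 0) (2 / z ^ 3)).summable
  have hsc : Summable fun k => 2 / (z + latt τ k) ^ 3 := by
    rw [hcube]; exact hs3.add hsi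
  have hsdd : Summable fun k => cubeSumDiff τ (z + latt τ k) := by
    simpa using hsc.sub hsd
  have hmain : ∑' k, logFactor₃ τ k z - cubeSum τ z =
      ∑' k, (2 / (z + latt τ k) ^ 3 - cubeSumDiff τ (z + latt τ k)) - 2 / z ^ 3 := by
    rw [hsc.tsum_sub hsdd, tsum_cubeSumDiff hτ z hsdd, hcube, hs3.tsum_add hsi, tsum_ite_eq]
    ring
  have hzn : ‖z‖⁻¹ ≤ 2 * x⁻¹ := by
    have h1 := tilt_le (by rwa [abs_of_pos hκ]) hσ z
    rw [← hx] at h1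
    rw [← div_eq_mul_inv, inv_eq_one_div, div_le_div_iff₀ (by linarith) (by linarith)]
    linarith
  rw [hmain]
  refine (norm_sub_le _ _).trans ?_
  rw [add_mul]
  gcongr
  · refine (tsum_of_norm_bounded (hu.mul_left _).hasSum hterm).trans ?_
    rw [tsum_mul_left, ← hU]
    apply le_of_eq; ring
  · rw [norm_div, norm_pow, Complex.norm_ofNat]
    calc 2 / ‖z‖ ^ 3 = 2 * ‖z‖⁻¹ ^ 3 := by rw [div_eq_mul_inv, inv_pow]
      _ ≤ 2 * (2 * x⁻¹) ^ 3 := by gcongr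
      _ = 16 * x ^ (-3 : ℝ) := by
        rw [Real.rpow_neg hz0.le, mul_pow, inv_pow]; norm_cast; ring
      _ ≤ _ := by
        gcongr
        norm_num

theorem norm_sub_le_of_deriv_le_rpow {κ σ : ℝ} (hκ : 0 < κ) {F F' : ℂ → ℂ} {C p : ℝ}
    (hp : 1 < p) (hF : ∀ z, 1 ≤ tilt κ σ z → HasDerivAt F (F' z) z)
    (hF' : ∀ z, 1 ≤ tilt κ σ z → ‖F' z‖ ≤ C * tilt κ σ z ^ (-p)) (hC : 0 ≤ C)
    {z : ℂ} (hz : 1 ≤ tilt κ σ z) {t : ℝ} (ht : 0 ≤ t) :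
    ‖F (z + t) - F z‖ ≤ C / (κ * (p - 1)) * tilt κ σ z ^ (1 - p) := by
  set x := tilt κ σ z with hx
  have hp1 : 0 < p - 1 := by linarith
  have htilt : ∀ u : ℝ, tilt κ σ (z + u) = x + κ * u := fun u => by
    rw [tilt_add, tilt_ofReal]
  have hge : ∀ u : ℝ, 0 ≤ u → 1 ≤ tilt κ σ (z + u) := fun u hu => by
    rw [htilt]; have := mul_nonneg hκ.le hu; linarith
  have hd : ∀ u : ℝ, 0 ≤ u → HasDerivAt (fun u : ℝ => F (z + u) - F z) (F' (z + u)) u := by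
    intro u hu
    have h1 : HasDerivAt (fun u : ℝ => z + (u : ℂ)) 1 u :=
      (Complex.ofRealCLM.hasDerivAt (x := u)).const_add z
    have := (hF _ (hge u hu)).scomp u h1
    simpa using this.sub_const (F z)
  have key := image_norm_le_of_norm_deriv_right_le_deriv_boundary'
    (f := fun u : ℝ => F (z + u) - F z) (f' := fun u => F' (z + u)) (a := 0) (b := t)
    (fun u hu => (hd u hu.1).continuousAt.continuousWithinAt)
    (fun u hu => (hd u hu.1).hasDerivWithinAt)
    (B := fun u => C / (κ * (p - 1)) * (x ^ (1 - p) - (x + κ * u) ^ (1 - p)))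
    (B' := fun u => C * (x + κ * u) ^ (-p)) (by simp)
    (fun u hu => by
      have : x + κ * u ≠ 0 := by
        have := hge u hu.1; rw [htilt] at this; linarith
      exact ContinuousAt.continuousWithinAt (by fun_prop (disch := exact Or.inl this)))
    (fun u hu => by
      have h0 : x + κ * u ≠ 0 := by
        have := hge u hu.1; rw [htilt] at this; linarith
      have h1 : HasDerivAt (fun u : ℝ => x + κ * u) κ u := by
        simpa using ((hasDerivAt_id u).const_mul κ).const_add x
      have h2 := (((h1.rpow_const (p := 1 - p) (Or.inl h0)).const_sub (x ^ (1 - p))).const_mul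
        (C / (κ * (p - 1))))
      refine (h2.congr_deriv ?_).hasDerivWithinAt
      rw [show 1 - p - 1 = -p by ring]
      field_simp
      ring)
    (fun u hu => by
      have := hF' _ (hge u hu.1)
      rwa [htilt] at this)
  have h := key ⟨ht, le_rfl⟩
  refine h.trans ?_
  have : 0 ≤ (x + κ * t) ^ (1 - p) := by
    have := mul_nonneg hκ.le ht
    positivity
  gcongr
  linarith

theorem exists_tendsto_of_deriv_le_rpow {κ σ : ℝ} (hκ : 0 < κ) {F F' : ℂ → ℂ} {C p : ℝ}
    (hp : 1 < p) (hF : ∀ z, 1 ≤ tilt κ σ z → HasDerivAt F (F' z) z)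
    (hF' : ∀ z, 1 ≤ tilt κ σ z → ‖F' z‖ ≤ C * tilt κ σ z ^ (-p)) (hC : 0 ≤ C) :
    ∃ c, Tendsto (fun t : ℝ => F t) atTop (nhds c) := by
  apply cauchySeq_tendsto_of_complete
  rw [Metric.cauchySeq_iff']
  intro ε hε
  have h1 : Tendsto (fun t : ℝ => C / (κ * (p - 1)) * (κ * t) ^ (1 - p)) atTop (nhds 0) := by
    have h2 := (tendsto_rpow_neg_atTop (show 0 < p - 1 by linarith)).comp
      (tendsto_id.const_mul_atTop hκ)
    simpa using h2.const_mul (C / (κ * (p - 1)))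
  obtain ⟨N, hN, hN1⟩ := ((h1.eventually_lt_const hε).and (eventually_ge_atTop (1 / κ))).exists
  refine ⟨N, fun t ht => ?_⟩
  have hN2 : 1 ≤ tilt κ σ (N : ℂ) := by
    rw [tilt_ofReal]
    rw [div_le_iff₀ hκ] at hN1; linarith
  have h3 := norm_sub_le_of_deriv_le_rpow hκ hp hF hF' hC hN2 (sub_nonneg.2 ht)
  rw [dist_eq_norm]
  rw [tilt_ofReal] at h3
  push_cast at h3
  rw [add_sub_cancel] at h3
  exact h3.trans_lt hN

theorem norm_sub_limit_le_of_deriv_le_rpow {κ σ : ℝ} (hκ : 0 < κ) {F F' : ℂ → ℂ} {C p : ℝ}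
    (hp : 1 < p) (hF : ∀ z, 1 ≤ tilt κ σ z → HasDerivAt F (F' z) z)
    (hF' : ∀ z, 1 ≤ tilt κ σ z → ‖F' z‖ ≤ C * tilt κ σ z ^ (-p)) (hC : 0 ≤ C) {c : ℂ}
    (hc : Tendsto (fun t : ℝ => F t) atTop (nhds c)) {z : ℂ} (hz : 1 ≤ tilt κ σ z) :
    ‖F z - c‖ ≤ C / (κ * (p - 1)) * tilt κ σ z ^ (1 - p) := by
  have h1 : Tendsto (fun t : ℝ => F (z + t) - F t) atTop (nhds 0) := by
    have h2 : Tendsto (fun t : ℝ => C * (κ * t) ^ (-p) * ‖z‖) atTop (nhds 0) := by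
      have h2 := (tendsto_rpow_neg_atTop (show 0 < p by linarith)).comp
        (tendsto_id.const_mul_atTop hκ)
      simpa using (h2.const_mul C).mul_const ‖z‖
    refine squeeze_zero_norm' ?_ h2
    filter_upwards [eventually_ge_atTop (1 / κ)] with t ht
    have ht1 : 1 ≤ κ * t := by rw [div_le_iff₀ hκ] at ht; linarith
    have := (convex_tilt_ge κ σ (κ * t)).norm_image_sub_le_of_norm_hasDerivWithin_le
      (f := F) (f' := F') (C := C * (κ * t) ^ (-p)) (x := t) (y := z + t)
      (fun w hw => (hF w (ht1.trans hw)).hasDerivWithinAt)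
      (fun w hw => (hF' w (ht1.trans hw)).trans (by
        gcongr ?_ * ?_
        exact Real.rpow_le_rpow_of_nonpos (by linarith) hw (by linarith)))
      (show κ * t ≤ tilt κ σ t by rw [tilt_ofReal])
      (show κ * t ≤ tilt κ σ (z + t) by rw [tilt_add, tilt_ofReal]; linarith)
    simpa using this
  have h3 : Tendsto (fun t : ℝ => F (z + t)) atTop (nhds c) := by
    simpa using h1.add hc
  have h4 : Tendsto (fun t : ℝ => ‖F (z + t) - F z‖) atTop (nhds ‖c - F z‖) :=
    (h3.sub_const _).norm
  rw [norm_sub_rev]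
  refine le_of_tendsto h4 ?_
  filter_upwards [eventually_ge_atTop 0] with t ht
  exact norm_sub_le_of_deriv_le_rpow hκ hp hF hF' hC hz ht

theorem exists_norm_sub_sq_le {H H₁ H₂ H₃ : ℂ → ℂ}
    (hd : ∀ κ σ : ℝ, 0 < κ → κ ≤ 1 → |σ| ≤ 1 → ∀ z, 1 ≤ tilt κ σ z →
      HasDerivAt H (H₁ z) z ∧ HasDerivAt H₁ (H₂ z) z ∧ HasDerivAt H₂ (H₃ z) z)
    (hb : ∀ κ σ : ℝ, 0 < κ → κ ≤ 1 → |σ| ≤ 1 → ∃ C : ℝ, 0 ≤ C ∧ ∀ z, 1 ≤ tilt κ σ z →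
      ‖H₃ z‖ ≤ C * tilt κ σ z ^ (-(5 / 2) : ℝ)) :
    ∃ β : ℂ, ∀ κ σ : ℝ, 0 < κ → κ ≤ 1 → |σ| ≤ 1 → ∃ C : ℝ, ∀ z, 1 ≤ tilt κ σ z →
      ‖H z - β * z ^ 2‖ ≤ C * ‖z‖ := by
  have hσ0 : |(0 : ℝ)| ≤ 1 := by simp
  have hlin : ∀ c z : ℂ, HasDerivAt (fun z => c * z) c z := fun c z => by
    simpa using (hasDerivAt_id z).const_mul c
  have hstep : ∀ c, Tendsto (fun t : ℝ => H₂ t) atTop (nhds c) → ∀ κ σ : ℝ, 0 < κ → κ ≤ 1 →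
      |σ| ≤ 1 → ∃ C : ℝ, 0 ≤ C ∧ ∀ z, 1 ≤ tilt κ σ z →
        ‖H₂ z - c‖ ≤ C * tilt κ σ z ^ (-(3 / 2) : ℝ) := by
    intro c hc κ σ hκ hκ1 hσ
    obtain ⟨C, hC0, hC⟩ := hb κ σ hκ hκ1 hσ
    refine ⟨C / (κ * (5 / 2 - 1)), div_nonneg hC0 (mul_nonneg hκ.le (by norm_num)), fun z hz => ?_⟩
    have := norm_sub_limit_le_of_deriv_le_rpow hκ (show (1 : ℝ) < 5 / 2 by norm_num)
      (fun z hz => (hd κ σ hκ hκ1 hσ z hz).2.2) hC hC0 hc hz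
    rwa [show (1 - 5 / 2 : ℝ) = -(3 / 2) by norm_num] at this
  obtain ⟨C₀, hC₀, hC₀'⟩ := hb 1 0 one_pos le_rfl hσ0
  obtain ⟨c, hc⟩ := exists_tendsto_of_deriv_le_rpow one_pos (show (1 : ℝ) < 5 / 2 by norm_num)
      (fun z hz => (hd 1 0 one_pos le_rfl hσ0 z hz).2.2) hC₀' hC₀
  have hd1 : ∀ κ σ : ℝ, 0 < κ → κ ≤ 1 → |σ| ≤ 1 → ∀ z, 1 ≤ tilt κ σ z →
      HasDerivAt (fun z => H₁ z - c * z) (H₂ z - c) z := fun κ σ hκ hκ1 hσ z hz =>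
    (hd κ σ hκ hκ1 hσ z hz).2.1.sub (hlin c z)
  obtain ⟨C₁, hC₁, hC₁'⟩ := hstep c hc 1 0 one_pos le_rfl hσ0
  obtain ⟨g, hg⟩ := exists_tendsto_of_deriv_le_rpow one_pos (show (1 : ℝ) < 3 / 2 by norm_num)
      (hd1 1 0 one_pos le_rfl hσ0) hC₁' hC₁
  refine ⟨c / 2, fun κ σ hκ hκ1 hσ => ?_⟩
  obtain ⟨C₂, hC₂, hC₂'⟩ := hstep c hc κ σ hκ hκ1 hσ
  have hD0 : 0 ≤ C₂ / (κ * (3 / 2 - 1)) := div_nonneg hC₂ (mul_nonneg hκ.le (by norm_num))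
  set D := C₂ / (κ * (3 / 2 - 1)) with hD
  have hbd : ∀ z, 1 ≤ tilt κ σ z → ‖H₁ z - c * z - g‖ ≤ D := fun z hz => by
    refine (norm_sub_limit_le_of_deriv_le_rpow hκ (show (1 : ℝ) < 3 / 2 by norm_num)
      (hd1 κ σ hκ hκ1 hσ) hC₂' hC₂ hg hz).trans ?_
    exact mul_le_of_le_one_right hD0 (Real.rpow_le_one_of_one_le_of_nonpos hz (by norm_num))
  set K : ℂ → ℂ := fun z => H z - c / 2 * z ^ 2 - g * z with hK
  set z₀ : ℂ := ((1 / κ : ℝ) : ℂ) with hz₀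
  have hz₀t : 1 ≤ tilt κ σ z₀ := by rw [hz₀, tilt_ofReal]; field_simp; exact le_rfl
  have hKd : ∀ z, 1 ≤ tilt κ σ z → HasDerivAt K (H₁ z - c * z - g) z := fun z hz => by
    have h1 := (((hasDerivAt_id z).pow 2).const_mul (c / 2))
    refine (((hd κ σ hκ hκ1 hσ z hz).1.sub h1).sub (hlin g z)).congr_deriv ?_
    simp; ring
  refine ⟨‖g‖ + D + 2 * (‖K z₀‖ + D * ‖z₀‖), fun z hz => ?_⟩
  have h1 := (convex_tilt_ge κ σ 1).norm_image_sub_le_of_norm_hasDerivWithin_le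
      (f := K) (fun w hw => (hKd w hw).hasDerivWithinAt) (fun w hw => hbd w hw) hz₀t hz
  have hzn : 1 ≤ 2 * ‖z‖ := hz.trans (tilt_le (by rwa [abs_of_pos hκ]) hσ z)
  have h2 : H z - c / 2 * z ^ 2 = (K z - K z₀) + K z₀ + g * z := by simp only [hK]; ring
  have h3 : 0 ≤ ‖K z₀‖ + D * ‖z₀‖ := by positivity
  calc ‖H z - c / 2 * z ^ 2‖ ≤ ‖K z - K z₀‖ + ‖K z₀‖ + ‖g * z‖ := by
        rw [h2]; exact norm_add₃_le
    _ ≤ D * (‖z‖ + ‖z₀‖) + ‖K z₀‖ + ‖g‖ * ‖z‖ := by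
        rw [norm_mul]
        gcongr
        exact h1.trans (by gcongr; exact norm_sub_le _ _)
    _ ≤ _ := by nlinarith

theorem norm_log_le_of_half_le {z : ℂ} (hz : 1 / 2 ≤ ‖z‖) : ‖Complex.log z‖ ≤ 10 * ‖z‖ := by
  have h0 : 0 < ‖z‖ := by linarith
  have h1 : ‖Complex.log z‖ ≤ |Real.log ‖z‖| + |z.arg| := by
    simpa [Complex.log_re, Complex.log_im] using Complex.norm_le_abs_re_add_abs_im (Complex.log z)
  have h2 : |Real.log ‖z‖| ≤ 2 * ‖z‖ := by
    rw [abs_le]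
    constructor
    · have := Real.one_sub_inv_le_log_of_pos h0
      have h3 : ‖z‖⁻¹ ≤ 2 := by
        rw [inv_le_comm₀ h0 two_pos]; linarith
      linarith
    · have := Real.log_le_sub_one_of_pos h0
      linarith
  have h3 := Complex.abs_arg_le_pi z
  have h4 := Real.pi_lt_four
  linarith

/-- The non-polynomial part of the expansion of `log G(z;τ)` up to `O(z)`. -/
def barnesLead (τ : ℝ) (z : ℂ) : ℂ :=
  z ^ 2 / (2 * τ) * Complex.log z - (1 + τ) / (2 * τ) * (z * Complex.log z)

theorem hasDerivAt_barnesLead {τ : ℝ} (hτ : 0 < τ) {z : ℂ} (hz : z ∈ slitPlane) :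
    HasDerivAt (barnesLead τ) (z / τ * Complex.log z + z / (2 * τ) -
      (1 + τ) / (2 * τ) * (Complex.log z + 1)) z ∧
    HasDerivAt (fun z => z / τ * Complex.log z + z / (2 * τ) -
      (1 + τ) / (2 * τ) * (Complex.log z + 1))
      (Complex.log z / τ + 3 / (2 * τ) - (1 + τ) / (2 * τ) * z⁻¹) z ∧
    HasDerivAt (fun z => Complex.log z / τ + 3 / (2 * τ) - (1 + τ) / (2 * τ) * z⁻¹)
      (cubeSum τ z) z := by
  have hτ0 : (τ : ℂ) ≠ 0 := by exact_mod_cast hτ.ne'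
  have hz0 : z ≠ 0 := slitPlane_ne_zero hz
  have hid := hasDerivAt_id z
  have hlog := Complex.hasDerivAt_log hz
  refine ⟨?_, ?_, ?_⟩
  · refine ((((hid.pow 2).div_const (2 * (τ : ℂ))).mul hlog).sub
      ((hid.mul hlog).const_mul ((1 + τ) / (2 * (τ : ℂ))))).congr_deriv ?_
    simp
    field_simp
  · refine ((((hid.div_const (τ : ℂ)).mul hlog).add (hid.div_const (2 * (τ : ℂ)))).sub
      ((hlog.add_const 1).const_mul ((1 + τ) / (2 * (τ : ℂ))))).congr_deriv ?_
    simp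
    field_simp
    ring
  · refine (((hlog.div_const (τ : ℂ)).add_const (3 / (2 * (τ : ℂ)))).sub
      ((hasDerivAt_inv hz0).const_mul ((1 + τ) / (2 * (τ : ℂ))))).congr_deriv ?_
    unfold cubeSum
    field_simp
    ring

theorem barnesG_asymptotic {τ : ℝ} (hτ : 0 < τ) :
    ∃ β : ℂ, ∀ κ σ : ℝ, 0 < κ → κ ≤ 1 → |σ| ≤ 1 → ∃ C : ℝ, ∀ z, 1 ≤ tilt κ σ z →
      ∃ E : ℂ, ‖E‖ ≤ C * ‖z‖ ∧
        barnesG z τ = Complex.exp (barnesLead τ z + β * z ^ 2 + E) := by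
  have hτ0 : (τ : ℂ) ≠ 0 := by exact_mod_cast hτ.ne'
  obtain ⟨β, hβ⟩ := exists_norm_sub_sq_le
    (H := fun z => ∑' k, logFactor τ k z - barnesLead τ z)
    (H₁ := fun z => ∑' k, logFactor₁ τ k z - (z / τ * Complex.log z + z / (2 * τ) -
      (1 + τ) / (2 * τ) * (Complex.log z + 1)))
    (H₂ := fun z => ∑' k, logFactor₂ τ k z -
      (Complex.log z / τ + 3 / (2 * τ) - (1 + τ) / (2 * τ) * z⁻¹))
    (H₃ := fun z => ∑' k, logFactor₃ τ k z - cubeSum τ z)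
    (fun κ σ hκ hκ1 hσ z hz => by
      have hz0 : 0 < tilt κ σ z := by linarith
      obtain ⟨d₁, d₂, d₃, -⟩ := hasDerivAt_tsum_logFactor hτ hκ hκ1 hσ hz0
      obtain ⟨e₁, e₂, e₃⟩ := hasDerivAt_barnesLead hτ (mem_slitPlane_of_tilt_pos hκ hz0)
      exact ⟨d₁.sub e₁, d₂.sub e₂, d₃.sub e₃⟩)
    (fun κ σ hκ hκ1 hσ => norm_tsum_logFactor₃_sub_le hτ hκ hκ1 hσ)
  refine ⟨β + bBarnes τ / (2 * τ), fun κ σ hκ hκ1 hσ => ?_⟩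
  obtain ⟨C, hC⟩ := hβ κ σ hκ hκ1 hσ
  refine ⟨C + 10 + 2 * ‖Complex.log τ‖ + ‖aBarnes τ / τ‖, fun z hz => ?_⟩
  have hz0 : 0 < tilt κ σ z := by linarith
  have hzn : 1 / 2 ≤ ‖z‖ := by
    have := tilt_le (by rwa [abs_of_pos hκ]) hσ z
    linarith
  have hzne : z ≠ 0 := slitPlane_ne_zero (mem_slitPlane_of_tilt_pos hκ hz0)
  refine ⟨(∑' k, logFactor τ k z - barnesLead τ z - β * z ^ 2) + Complex.log z - Complex.log τ +
    aBarnes τ / τ * z, ?_, ?_⟩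
  · have h1 := hC z hz
    have h2 := norm_log_le_of_half_le hzn
    have h3 : ‖Complex.log τ‖ ≤ 2 * ‖Complex.log τ‖ * ‖z‖ := by
      nlinarith [norm_nonneg (Complex.log (τ : ℂ))]
    calc _ ≤ ‖∑' k, logFactor τ k z - barnesLead τ z - β * z ^ 2‖ + ‖Complex.log z‖ +
          ‖Complex.log τ‖ + ‖aBarnes τ / τ * z‖ := by
          refine (norm_add_le _ _).trans ?_
          gcongr
          refine (norm_sub_le _ _).trans ?_
          gcongr
          exact norm_add_le _ _
      _ ≤ C * ‖z‖ + 10 * ‖z‖ + 2 * ‖Complex.log τ‖ * ‖z‖ + ‖aBarnes τ / τ‖ * ‖z‖ := by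
          rw [norm_mul]
          gcongr
      _ = _ := by ring
  · rw [barnesG_eq_exp hτ hκ hκ1 hσ hz0, Complex.exp_add, Complex.exp_add,
      Complex.exp_log (div_ne_zero hzne hτ0)]
    have : z / τ = Complex.exp (Complex.log z - Complex.log τ) := by
      rw [Complex.exp_sub, Complex.exp_log hzne, Complex.exp_log hτ0]
    rw [this, ← Complex.exp_add, ← Complex.exp_add]
    congr 1
    ring

theorem norm_log_add_sub_log_le {κ σ : ℝ} (hκ : 0 < κ) (hκ1 : κ ≤ 1) (hσ : |σ| ≤ 1) {s c : ℂ}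
    {x : ℝ} (hx : 0 < x) (hs : x ≤ tilt κ σ s) (hsc : x ≤ tilt κ σ (s + c)) :
    ‖Complex.log (s + c) - Complex.log s‖ ≤ 2 / x * ‖c‖ := by
  have := (convex_tilt_ge κ σ x).norm_image_sub_le_of_norm_hasDerivWithin_le
    (f := Complex.log) (f' := fun w => w⁻¹) (C := 2 / x) (x := s) (y := s + c)
    (fun w hw => (Complex.hasDerivAt_log
      (mem_slitPlane_of_tilt_pos hκ (hx.trans_le hw))).hasDerivWithinAt)
    (fun w hw => by
      have h1 : x ≤ tilt κ σ w := hw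
      have h2 := tilt_le (by rwa [abs_of_pos hκ]) hσ w
      rw [norm_inv, inv_eq_one_div, div_le_div_iff₀ (by linarith) hx]
      linarith) hs hsc
  simpa using this

theorem barnesG_add_asymptotic {τ : ℝ} (hτ : 0 < τ) :
    ∃ β : ℂ, ∀ κ σ : ℝ, 0 < κ → κ ≤ 1 → |σ| ≤ 1 → ∀ c : ℂ, ∃ R C : ℝ, ∀ s : ℂ, R ≤ ‖s‖ →
      κ * ‖s‖ ≤ tilt κ σ s → ∃ E : ℂ, ‖E‖ ≤ C * ‖s‖ ∧
        barnesG (c + s) τ = Complex.exp (s ^ 2 / (2 * τ) * Complex.log s + β * s ^ 2 +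
          (c - (1 + τ) / 2) * (s * Complex.log s / τ) + E) := by
  have hτ0 : (τ : ℂ) ≠ 0 := by exact_mod_cast hτ.ne'
  obtain ⟨β, hβ⟩ := barnesG_asymptotic hτ
  refine ⟨β, fun κ σ hκ hκ1 hσ c => ?_⟩
  obtain ⟨C, hC⟩ := hβ κ σ hκ hκ1 hσ
  set M := 1 + ‖c‖ with hM
  have hM0 : 0 < M := by positivity
  refine ⟨max 1 (max (2 / κ) (4 * ‖c‖ / κ)), |C| * M + ‖c ^ 2 / (2 * (τ : ℂ))‖ * 10 +
    ‖1 / (2 * (τ : ℂ))‖ * (M ^ 2 * (4 / κ * ‖c‖)) +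
    ‖(1 + τ) / (2 * (τ : ℂ))‖ * (‖c‖ * 10 + M * (4 / κ * ‖c‖)) + ‖β * (2 * c)‖ + ‖β * c ^ 2‖,
    fun s hs hts => ?_⟩
  rw [max_le_iff, max_le_iff, div_le_iff₀ hκ, div_le_iff₀ hκ] at hs
  obtain ⟨hs1, hs2, hs3⟩ := hs
  set r := ‖s‖ with hr
  have hr0 : 0 < r := by linarith
  have hct : -(2 * ‖c‖) ≤ tilt κ σ c :=
    (abs_le.1 (abs_tilt_le (by rwa [abs_of_pos hκ]) hσ c)).1
  have hsc : κ * r / 2 ≤ tilt κ σ (s + c) := by rw [tilt_add]; linarith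
  have hss : κ * r / 2 ≤ tilt κ σ s := by
    have := mul_pos hκ hr0
    linarith
  have hd := norm_log_add_sub_log_le hκ hκ1 hσ (x := κ * r / 2) (by positivity) hss hsc
  obtain ⟨E, hE, hG⟩ := hC (s + c) (by linarith)
  have hzn : ‖s + c‖ ≤ M * r := by
    have := norm_add_le s c
    nlinarith [norm_nonneg c]
  have hlog : ‖Complex.log s‖ ≤ 10 * r := norm_log_le_of_half_le (by rw [← hr]; linarith)
  set d := Complex.log (s + c) - Complex.log s with hdd
  have hdr : ‖d‖ ≤ 4 / κ * ‖c‖ * r⁻¹ := by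
    refine hd.trans (le_of_eq ?_)
    field_simp
    ring
  refine ⟨E + c ^ 2 / (2 * τ) * Complex.log s + 1 / (2 * τ) * ((s + c) ^ 2 * d) -
    (1 + τ) / (2 * τ) * (c * Complex.log s + (s + c) * d) + β * (2 * c) * s + β * c ^ 2, ?_, ?_⟩
  · have b1 : ‖E‖ ≤ |C| * M * r := hE.trans (by
      rw [mul_assoc]; gcongr; exact le_abs_self C)
    have b2 : ‖(s + c) ^ 2 * d‖ ≤ M ^ 2 * (4 / κ * ‖c‖) * r := by
      rw [norm_mul, norm_pow]
      calc ‖s + c‖ ^ 2 * ‖d‖ ≤ (M * r) ^ 2 * (4 / κ * ‖c‖ * r⁻¹) := by gcongr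
        _ = _ := by field_simp
    have b3 : ‖c * Complex.log s + (s + c) * d‖ ≤ (‖c‖ * 10 + M * (4 / κ * ‖c‖)) * r := by
      refine (norm_add_le _ _).trans ?_
      rw [norm_mul, norm_mul]
      calc ‖c‖ * ‖Complex.log s‖ + ‖s + c‖ * ‖d‖
          ≤ ‖c‖ * (10 * r) + M * r * (4 / κ * ‖c‖ * r⁻¹) := by gcongr
        _ = ‖c‖ * (10 * r) + M * (4 / κ * ‖c‖) * 1 := by field_simp
        _ ≤ ‖c‖ * (10 * r) + M * (4 / κ * ‖c‖) * r := by gcongr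
        _ = _ := by ring
    calc _ ≤ ‖E‖ + ‖c ^ 2 / (2 * τ) * Complex.log s‖ + ‖1 / (2 * τ) * ((s + c) ^ 2 * d)‖ +
          ‖(1 + τ) / (2 * τ) * (c * Complex.log s + (s + c) * d)‖ + ‖β * (2 * c) * s‖ +
          ‖β * c ^ 2‖ := by
          refine (norm_add_le _ _).trans ?_
          gcongr
          refine (norm_add_le _ _).trans ?_
          gcongr
          refine (norm_sub_le _ _).trans ?_
          gcongr
          exact norm_add₃_le
      _ ≤ |C| * M * r + ‖c ^ 2 / (2 * (τ : ℂ))‖ * (10 * r) +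
          ‖1 / (2 * (τ : ℂ))‖ * (M ^ 2 * (4 / κ * ‖c‖) * r) +
          ‖(1 + τ) / (2 * (τ : ℂ))‖ * ((‖c‖ * 10 + M * (4 / κ * ‖c‖)) * r) +
          ‖β * (2 * c)‖ * r + ‖β * c ^ 2‖ * r := by
          rw [norm_mul _ (Complex.log s), norm_mul _ ((s + c) ^ 2 * d),
            norm_mul _ (c * Complex.log s + (s + c) * d), norm_mul _ s]
          gcongr
          exact le_mul_of_one_le_right (norm_nonneg _) hs1
      _ = _ := by ring
  · rw [add_comm c s, hG]
    congr 1
    have hl : Complex.log (s + c) = Complex.log s + d := by rw [hdd]; ring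
    unfold barnesLead
    rw [hl]
    field_simp
    ring

/-- `f s = exp (A s + O(s))` for `s → ∞` in `D`. -/
def ExpAsymp (D : Set ℂ) (f A : ℂ → ℂ) : Prop :=
  ∃ R C : ℝ, ∀ s ∈ D, R ≤ ‖s‖ → ∃ E : ℂ, ‖E‖ ≤ C * ‖s‖ ∧ f s = Complex.exp (A s + E)

namespace ExpAsymp

variable {D : Set ℂ} {f g A B : ℂ → ℂ}

theorem one : ExpAsymp D (fun _ => 1) (fun _ => 0) :=
  ⟨0, 0, fun _ _ _ => ⟨0, by simp, by simp⟩⟩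

theorem mul (hf : ExpAsymp D f A) (hg : ExpAsymp D g B) :
    ExpAsymp D (fun s => f s * g s) (fun s => A s + B s) := by
  obtain ⟨R₁, C₁, h₁⟩ := hf
  obtain ⟨R₂, C₂, h₂⟩ := hg
  refine ⟨max R₁ R₂, C₁ + C₂, fun s hs hR => ?_⟩
  obtain ⟨E₁, hE₁, e₁⟩ := h₁ s hs ((le_max_left _ _).trans hR)
  obtain ⟨E₂, hE₂, e₂⟩ := h₂ s hs ((le_max_right _ _).trans hR)
  refine ⟨E₁ + E₂, ?_, ?_⟩
  · rw [add_mul]; exact (norm_add_le _ _).trans (add_le_add hE₁ hE₂)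
  · beta_reduce
    rw [e₁, e₂, ← Complex.exp_add]; congr 1; ring

theorem div (hf : ExpAsymp D f A) (hg : ExpAsymp D g B) :
    ExpAsymp D (fun s => f s / g s) (fun s => A s - B s) := by
  obtain ⟨R₁, C₁, h₁⟩ := hf
  obtain ⟨R₂, C₂, h₂⟩ := hg
  refine ⟨max R₁ R₂, C₁ + C₂, fun s hs hR => ?_⟩
  obtain ⟨E₁, hE₁, e₁⟩ := h₁ s hs ((le_max_left _ _).trans hR)
  obtain ⟨E₂, hE₂, e₂⟩ := h₂ s hs ((le_max_right _ _).trans hR)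
  refine ⟨E₁ - E₂, ?_, ?_⟩
  · rw [add_mul]; exact (norm_sub_le _ _).trans (add_le_add hE₁ hE₂)
  · beta_reduce
    rw [e₁, e₂, ← Complex.exp_sub]; congr 1; ring

theorem prod {ι : Type*} (t : Finset ι) {f A : ι → ℂ → ℂ}
    (h : ∀ i ∈ t, ExpAsymp D (f i) (A i)) :
    ExpAsymp D (fun s => ∏ i ∈ t, f i s) (fun s => ∑ i ∈ t, A i s) := by
  classical
  induction t using Finset.induction_on with
  | empty => simpa using one
  | insert i t hi ih =>
    simp only [Finset.prod_insert hi, Finset.sum_insert hi]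
    exact (h i (Finset.mem_insert_self _ _)).mul
      (ih fun j hj => h j (Finset.mem_insert_of_mem hj))

theorem ite (P : Prop) [Decidable P] (hf : ExpAsymp D f A) :
    ExpAsymp D (fun s => if P then f s else 1) (fun s => if P then A s else 0) := by
  by_cases hP : P
  · simpa only [hP, if_true] using hf
  · simpa only [hP, if_false] using one

end ExpAsymp

theorem log_neg_eq {χ : ℝ} (hχ : χ = 1 ∨ χ = -1) {s : ℂ} (hs : 0 < χ * s.im) :
    Complex.log (-s) = Complex.log s - Real.pi * Complex.I * χ := by
  rcases hχ with rfl | rfl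
  · have h : 0 < s.im := by linarith
    simp only [Complex.log, norm_neg, Complex.arg_neg_eq_arg_sub_pi_of_im_pos h]
    push_cast; ring
  · have h : s.im < 0 := by linarith
    simp only [Complex.log, norm_neg, Complex.arg_neg_eq_arg_add_pi_of_im_neg h]
    push_cast; ring

theorem expAsymp_barnesG {τ : ℝ} (hτ : 0 < τ) :
    ∃ β : ℂ, ∀ κ χ : ℝ, 0 < κ → κ ≤ 1 → (χ = 1 ∨ χ = -1) → ∀ c : ℂ,
      ExpAsymp {s | 2 * κ * ‖s‖ ≤ χ * s.im} (fun s => barnesG (c + s) τ)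
        (fun s => s ^ 2 / (2 * τ) * Complex.log s + β * s ^ 2 +
          (c - (1 + τ) / 2) * (s * Complex.log s / τ)) ∧
      ExpAsymp {s | 2 * κ * ‖s‖ ≤ χ * s.im} (fun s => barnesG (c - s) τ)
        (fun s => s ^ 2 / (2 * τ) * Complex.log s + β * s ^ 2 -
          Real.pi * Complex.I * χ / (2 * τ) * s ^ 2 -
          (c - (1 + τ) / 2) * (s * Complex.log s / τ)) := by
  obtain ⟨β, hβ⟩ := barnesG_add_asymptotic hτ
  refine ⟨β, fun κ χ hκ hκ1 hχ c => ?_⟩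
  have hχ1 : |χ| ≤ 1 := by rcases hχ with rfl | rfl <;> simp
  have hre : ∀ s : ℂ, |κ * s.re| ≤ κ * ‖s‖ := fun s => by
    rw [abs_mul, abs_of_pos hκ]
    gcongr
    exact Complex.abs_re_le_norm s
  constructor
  · obtain ⟨R, C, h⟩ := hβ κ χ hκ hκ1 hχ1 c
    refine ⟨R, C, fun s hs hR => h s hR ?_⟩
    have h1 : 2 * κ * ‖s‖ ≤ χ * s.im := hs
    have h2 := (abs_le.1 (hre s)).1
    unfold tilt
    linarith
  · obtain ⟨R, C, h⟩ := hβ κ (-χ) hκ hκ1 (by rwa [abs_neg]) c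
    refine ⟨max R 1, C + ‖(c - (1 + τ) / 2) / τ * (Real.pi * Complex.I * χ)‖,
      fun s hs hR => ?_⟩
    have h1 : 2 * κ * ‖s‖ ≤ χ * s.im := hs
    have h2 := (abs_le.1 (hre s)).2
    have hs1 : 1 ≤ ‖s‖ := (le_max_right _ _).trans hR
    have hpos : 0 < κ * ‖s‖ := by positivity
    obtain ⟨E, hE, hG⟩ := h (-s) (by rw [norm_neg]; exact (le_max_left _ _).trans hR) (by
      unfold tilt
      rw [norm_neg, Complex.neg_re, Complex.neg_im]
      linarith)
    rw [norm_neg] at hE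
    refine ⟨E + (c - (1 + τ) / 2) / τ * (Real.pi * Complex.I * χ) * s, ?_, ?_⟩
    · refine (norm_add_le _ _).trans ?_
      rw [add_mul, norm_mul _ s]
      gcongr
    · beta_reduce
      rw [sub_eq_add_neg c s, hG, log_neg_eq hχ (by linarith)]
      congr 1
      ring

theorem sum_ite_lt_sub_mul {m q : ℕ} (hm : m ≤ q) (b : Fin q → ℂ) (X Y : ℂ) :
    ∑ j : Fin q, (if (j : ℕ) < m then X - b j * Y else 0) =
      m * X - (∑ j : Fin q, if (j : ℕ) < m then b j else 0) * Y := by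
  have h : ∑ j : Fin q, (if (j : ℕ) < m then (1 : ℂ) else 0) = m := by
    rw [Finset.sum_boole, Fin.card_filter_val_lt, min_eq_right hm]
  rw [← h, Finset.sum_mul, Finset.sum_mul, ← Finset.sum_sub_distrib]
  refine Finset.sum_congr rfl fun j _ => ?_
  split_ifs <;> ring

theorem sum_ite_ge_sub_mul {m q : ℕ} (hm : m ≤ q) (b : Fin q → ℂ) (X Y : ℂ) :
    ∑ j : Fin q, (if m ≤ (j : ℕ) then X - b j * Y else 0) =
      (q - m) * X - (∑ j : Fin q, if m ≤ (j : ℕ) then b j else 0) * Y := by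
  have h := sum_ite_lt_sub_mul hm b X Y
  have h1 := sum_ite_lt_sub_mul le_rfl b X Y
  simp only [Fin.is_lt, if_true] at h1
  have split : ∀ g : Fin q → ℂ, ∑ j : Fin q, (if m ≤ (j : ℕ) then g j else 0) =
      ∑ j, g j - ∑ j : Fin q, (if (j : ℕ) < m then g j else 0) := fun g => by
    rw [← Finset.sum_sub_distrib]
    refine Finset.sum_congr rfl fun j _ => ?_
    by_cases hj : (j : ℕ) < m
    · simp [hj, hj.not_ge]
    · simp [hj, not_lt.1 hj]
  rw [split, split, h, h1]
  ring

theorem expAsymp_calG {τ : ℝ} (hτ : 0 < τ) {m n p q : ℕ} (hm : m ≤ q) (hn : n ≤ p)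
    (hN : paramN m n p q = 0) (a : Fin p → ℂ) (b : Fin q → ℂ) {κ χ : ℝ} (hκ : 0 < κ)
    (hκ1 : κ ≤ 1) (hχ : χ = 1 ∨ χ = -1) :
    ExpAsymp {s | 2 * κ * ‖s‖ ≤ χ * s.im} (fun s => calG m n a b s τ)
      (fun s => (Real.pi : ℂ) * Complex.I * (χ : ℂ) / (4 * (τ : ℂ)) * ((p - q : ℤ) : ℂ) * s ^ 2
        - paramMu m n a b / (τ : ℂ) * s * Complex.log s) := by
  obtain ⟨β, hβ⟩ := expAsymp_barnesG hτ
  have hτ0 : (τ : ℂ) ≠ 0 := by exact_mod_cast hτ.ne'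
  have h := fun c => hβ κ χ hκ hκ1 hχ c
  have key := ((ExpAsymp.prod Finset.univ fun (j : Fin q) _ =>
      (h (b j)).2.ite ((j : ℕ) < m)).mul
    (ExpAsymp.prod Finset.univ fun (j : Fin p) _ =>
      (h (1 + τ - a j)).1.ite ((j : ℕ) < n))).div
    ((ExpAsymp.prod Finset.univ fun (j : Fin q) _ =>
      (h (1 + τ - b j)).1.ite (m ≤ (j : ℕ))).mul
    (ExpAsymp.prod Finset.univ fun (j : Fin p) _ =>
      (h (a j)).2.ite (n ≤ (j : ℕ))))
  obtain ⟨R, C, hRC⟩ := key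
  refine ⟨R, C, fun s hs hR => ?_⟩
  obtain ⟨E, hE, hG⟩ := hRC s hs hR
  refine ⟨E, hE, hG.trans ?_⟩
  congr 2
  beta_reduce
  set P := s ^ 2 / (2 * τ) * Complex.log s + β * s ^ 2 with hP
  set T := Real.pi * Complex.I * χ / (2 * τ) * s ^ 2 with hT
  set Q := s * Complex.log s / τ with hQ
  have e₁ : ∀ c : ℂ, P - T - (c - (1 + τ) / 2) * Q = (P - T + (1 + τ) / 2 * Q) - c * Q :=
    fun c => by ring
  have e₂ : ∀ c : ℂ, P + (1 + τ - c - (1 + τ) / 2) * Q = (P + (1 + τ) / 2 * Q) - c * Q :=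
    fun c => by ring
  simp only [e₁, e₂]
  rw [sum_ite_lt_sub_mul hm, sum_ite_lt_sub_mul hn, sum_ite_ge_sub_mul hm, sum_ite_ge_sub_mul hn]
  have hN' : (2 * (m + n) - p - q : ℂ) = 0 := by
    unfold paramN at hN
    exact_mod_cast congrArg (Int.cast : ℤ → ℂ) hN
  have hp : (p : ℂ) = 2 * (m + n) - q := by linear_combination -hN'
  have hmu : paramMu m n a b / τ * s * Complex.log s = paramMu m n a b * Q := by
    rw [hQ]; ring
  have hT' : (Real.pi : ℂ) * Complex.I * χ / (4 * τ) * ((p - q : ℤ) : ℂ) * s ^ 2 =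
      (p - q) / 2 * T := by
    rw [hT]; push_cast; field_simp; ring
  rw [hmu, hT']
  unfold paramMu
  linear_combination (P + (1 + τ) / 2 * Q - T / 2) * hN'

theorem sector_mem {ε : ℝ} (hε : ε ∈ Set.Ioo 0 Real.pi) {s : ℂ} :
    (s ∈ Splus ε → Real.sin ε * ‖s‖ ≤ s.im) ∧ (s ∈ Sminus ε → Real.sin ε * ‖s‖ ≤ -s.im) := by
  have aux : ∀ θ : ℝ, ε ≤ θ → θ ≤ Real.pi - ε → Real.sin ε ≤ Real.sin θ := fun θ h1 h2 => by
    rcases le_total θ (Real.pi / 2) with h | h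
    · exact Real.sin_le_sin_of_le_of_le_pi_div_two (by linarith [hε.1, Real.pi_pos]) h h1
    · rw [← Real.sin_pi_sub θ]
      exact Real.sin_le_sin_of_le_of_le_pi_div_two (by linarith [hε.1, Real.pi_pos])
        (by linarith) (by linarith)
  have him : ‖s‖ * Real.sin s.arg = s.im := Complex.norm_mul_sin_arg s
  constructor
  · rintro ⟨-, h1, h2⟩
    have := mul_le_mul_of_nonneg_right (aux _ h1 h2) (norm_nonneg s)
    linarith
  · rintro ⟨-, h1, h2⟩
    have := mul_le_mul_of_nonneg_right (aux _ h1 h2) (norm_nonneg s)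
    rw [Real.sin_neg] at this
    linarith

/-- Asymptotics of `𝒢^{m,n}_{p,q}(s)` in the sectors `S±_ε`, case `N = 0`. -/
theorem calG_asymptotic_quadratic (τ : ℝ) (hτ : 0 < τ) (ε : ℝ) (hε : ε ∈ Set.Ioo 0 Real.pi)
    (m n : ℕ) {p q : ℕ} (hm : m ≤ q) (hn : n ≤ p) (hN : paramN m n p q = 0)
    (a : Fin p → ℂ) (b : Fin q → ℂ) :
    ∃ R C : ℝ, 0 < R ∧ 0 < C ∧
      ∀ s : ℂ, R ≤ ‖s‖ →
        (s ∈ Splus ε →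
          calG m n a b s (τ : ℂ) ≠ 0 ∧
          ∃ E : ℂ, ‖E‖ ≤ C * ‖s‖ ∧
            calG m n a b s (τ : ℂ) =
              Complex.exp ((Real.pi : ℂ) * Complex.I * (1 : ℂ) / (4 * (τ : ℂ))
                  * ((p - q : ℤ) : ℂ) * s ^ 2
                - paramMu m n a b / (τ : ℂ) * s * Complex.log s + E)) ∧
        (s ∈ Sminus ε →
          calG m n a b s (τ : ℂ) ≠ 0 ∧
          ∃ E : ℂ, ‖E‖ ≤ C * ‖s‖ ∧
            calG m n a b s (τ : ℂ) =
              Complex.exp ((Real.pi : ℂ) * Complex.I * (-1 : ℂ) / (4 * (τ : ℂ))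
                  * ((p - q : ℤ) : ℂ) * s ^ 2
                - paramMu m n a b / (τ : ℂ) * s * Complex.log s + E)) := by
  have hsin : 0 < Real.sin ε := Real.sin_pos_of_pos_of_lt_pi hε.1 hε.2
  have hκ : 0 < Real.sin ε / 2 := by positivity
  have hκ1 : Real.sin ε / 2 ≤ 1 := by linarith [Real.sin_le_one ε]
  obtain ⟨R₁, C₁, h₁⟩ := expAsymp_calG hτ hm hn hN a b hκ hκ1 (Or.inl rfl)
  obtain ⟨R₂, C₂, h₂⟩ := expAsymp_calG hτ hm hn hN a b hκ hκ1 (Or.inr rfl)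
  refine ⟨max 1 (max R₁ R₂), max 1 (max C₁ C₂), by positivity, by positivity,
    fun s hs => ⟨fun hsε => ?_, fun hsε => ?_⟩⟩
  · obtain ⟨E, hE, hG⟩ := h₁ s (show 2 * (Real.sin ε / 2) * ‖s‖ ≤ 1 * s.im by
      linarith [(sector_mem hε).1 hsε]) (by
      exact ((le_max_left _ _).trans (le_max_right _ _)).trans hs)
    beta_reduce at hG
    rw [Complex.ofReal_one] at hG
    refine ⟨by rw [hG]; exact Complex.exp_ne_zero _, E, hE.trans ?_, hG⟩
    gcongr
    exact (le_max_left _ _).trans (le_max_right _ _)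
  · obtain ⟨E, hE, hG⟩ := h₂ s (show 2 * (Real.sin ε / 2) * ‖s‖ ≤ -1 * s.im by
      linarith [(sector_mem hε).2 hsε]) (by
      exact ((le_max_right _ _).trans (le_max_right _ _)).trans hs)
    beta_reduce at hG
    rw [Complex.ofReal_neg, Complex.ofReal_one] at hG
    refine ⟨by rw [hG]; exact Complex.exp_ne_zero _, E, hE.trans ?_, hG⟩
    gcongr
    exact (le_max_right _ _).trans (le_max_right _ _)
end
end

section
/- Let τ > 0, ε ∈ (0, π), and let m ≤ q, n ≤ p be nonnegative integers with N := 2(m+n)−p−q = 0 and p = q, a ∈ ℂ^p, b ∈ ℂ^q with μ = 0 and ν = 0. Then there exist R, C > 0 such that for every s ∈ S⁺_ε ∪ S⁻_ε with |s| ≥ R, one has 𝒢^{m,n}_{p,q}(a;b|s;τ) ≠ 0 and 𝒢^{m,n}_{p,q}(a;b|s;τ) = exp( (ξ/(2τ))·log|s| + E(s) ) for some E(s) ∈ ℂ with |E(s)| ≤ C. -/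
open Complex Filter MeasureTheory Set

noncomputable section

/-- The lattice point `iτ + j` with index `(i, j)`. -/
def latticePoint (τ : ℝ) (k : ℕ × ℕ) : ℝ := k.1 * τ + k.2

lemma latticePoint_nonneg {τ : ℝ} (hτ : 0 < τ) (k : ℕ × ℕ) : 0 ≤ latticePoint τ k := by
  unfold latticePoint; positivity

lemma min_le_latticePoint {τ : ℝ} (hτ : 0 < τ) {k : ℕ × ℕ} (hk : k ≠ (0, 0)) :
    min τ 1 ≤ latticePoint τ k := by
  obtain ⟨i, j⟩ := k
  unfold latticePoint
  rcases Nat.eq_zero_or_pos i with rfl | hi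
  · have hj : 1 ≤ j := Nat.one_le_iff_ne_zero.2 fun h => hk (by simp [h])
    have : (1 : ℝ) ≤ j := by exact_mod_cast hj
    simpa using Or.inr this
  · have : (1 : ℝ) ≤ i := by exact_mod_cast hi
    have h2 : (0 : ℝ) ≤ j := by positivity
    refine (min_le_left _ _).trans ?_
    simp only
    nlinarith

lemma latticePoint_pos {τ : ℝ} (hτ : 0 < τ) {k : ℕ × ℕ} (hk : k ≠ (0, 0)) :
    0 < latticePoint τ k :=
  (lt_min hτ one_pos).trans_le (min_le_latticePoint hτ hk)

lemma summable_latticePoint {τ : ℝ} (hτ : 0 < τ) :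
    Summable fun k : ℕ × ℕ => ((1 + latticePoint τ k) ^ 3)⁻¹ := by
  set t := min τ 1 with ht
  have ht0 : 0 < t := lt_min hτ one_pos
  have h1 : Summable fun i : ℕ => (((i : ℝ) + 1) ^ (3 / 2 : ℝ))⁻¹ := by
    have := (summable_nat_add_iff 1).2
      (Real.summable_nat_rpow_inv.2 (by norm_num : (1 : ℝ) < 3 / 2))
    simpa using this
  have h2 := (h1.mul_of_nonneg h1 (fun i => by positivity) (fun i => by positivity)).mul_left
    ((t ^ 3)⁻¹)
  refine h2.of_nonneg_of_le
    (fun k => inv_nonneg.2 (pow_nonneg (by linarith [latticePoint_nonneg hτ k]) 3)) fun k => ?_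
  obtain ⟨i, j⟩ := k
  simp only [← mul_inv]
  have hi : (0 : ℝ) ≤ i := by positivity
  have hj : (0 : ℝ) ≤ j := by positivity
  have hcube (x : ℝ) (hx : 0 ≤ x) : x ^ (3 / 2 : ℝ) * x ^ (3 / 2 : ℝ) = x ^ 3 := by
    rw [← Real.rpow_add_of_nonneg hx (by norm_num) (by norm_num), ← Real.rpow_natCast]
    norm_num
  apply inv_anti₀ (by positivity)
  have hw : t * (i + j + 1) ≤ 1 + latticePoint τ (i, j) := by
    unfold latticePoint
    have := min_le_left τ 1
    have := min_le_right τ 1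
    simp only
    nlinarith
  calc t ^ 3 * (((i : ℝ) + 1) ^ (3 / 2 : ℝ) * ((j : ℝ) + 1) ^ (3 / 2 : ℝ))
      ≤ t ^ 3 * (((i : ℝ) + j + 1) ^ (3 / 2 : ℝ) * ((i : ℝ) + j + 1) ^ (3 / 2 : ℝ)) := by
        gcongr <;> linarith
    _ = (t * (i + j + 1)) ^ 3 := by rw [hcube _ (by positivity)]; ring
    _ ≤ _ := by gcongr

/-- The remainder of `log (1 + u)` after its second-order Taylor polynomial. -/
def logRem (u : ℂ) : ℂ := log (1 + u) - u + u ^ 2 / 2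

lemma norm_logRem_le {u : ℂ} (hu : ‖u‖ ≤ 1 / 2) : ‖logRem u‖ ≤ ‖u‖ ^ 3 := by
  have h := Complex.norm_log_sub_logTaylor_le 2 (hu.trans_lt (by norm_num))
  have h2 : log (1 + u) - logTaylor 3 u = logRem u := by
    simp [logTaylor, Finset.sum_range_succ, logRem]; ring
  rw [h2] at h
  refine h.trans ?_
  have : (1 - ‖u‖)⁻¹ ≤ 2 := by
    rw [inv_le_comm₀ (by linarith) (by norm_num)]; linarith
  have h3 : 0 ≤ ‖u‖ ^ 3 := by positivity
  norm_num
  nlinarith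

/-- Points whose imaginary part is comparable to their modulus: a union of two open sectors. -/
def imSector (κ : ℝ) : Set ℂ := {s | κ * ‖s‖ ≤ |s.im|}

lemma add_norm_le_of_mem_imSector {κ : ℝ} (hκ : 0 < κ) {s : ℂ} (hs : s ∈ imSector κ) {x : ℝ}
    (hx : 0 ≤ x) : x + ‖s‖ ≤ (1 + 2 / κ) * ‖(x : ℂ) + s‖ := by
  have h1 : |s.im| ≤ ‖(x : ℂ) + s‖ := by simpa using abs_im_le_norm ((x : ℂ) + s)
  have h2 : ‖s‖ ≤ 1 / κ * ‖(x : ℂ) + s‖ := by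
    rw [div_mul_eq_mul_div, one_mul, le_div_iff₀ hκ, mul_comm]
    exact (show κ * ‖s‖ ≤ |s.im| from hs).trans h1
  have h3 : x ≤ ‖(x : ℂ) + s‖ + ‖s‖ := by
    have := norm_sub_le ((x : ℂ) + s) s
    simpa [abs_of_nonneg hx] using this
  calc x + ‖s‖ ≤ ‖(x : ℂ) + s‖ + ‖s‖ + ‖s‖ := by linarith
    _ ≤ ‖(x : ℂ) + s‖ + 1 / κ * ‖(x : ℂ) + s‖ + 1 / κ * ‖(x : ℂ) + s‖ := by gcongr
    _ = _ := by ring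

lemma neg_mem_imSector {κ : ℝ} {s : ℂ} (hs : s ∈ imSector κ) : -s ∈ imSector κ := by
  simpa [imSector] using hs

lemma mem_imSector_of_mem {ε : ℝ} (hε : ε ∈ Set.Ioo 0 Real.pi) {s : ℂ}
    (hs : s ∈ Splus ε ∪ Sminus ε) : s ∈ imSector (Real.sin ε) := by
  have key (x : ℝ) (h1 : ε ≤ x) (h2 : x ≤ Real.pi - ε) : Real.sin ε ≤ Real.sin x := by
    have := hε.1
    rcases le_total x (Real.pi / 2) with h | h
    · exact Real.sin_le_sin_of_le_of_le_pi_div_two (by linarith) h h1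
    · rw [← Real.sin_pi_sub x]
      exact Real.sin_le_sin_of_le_of_le_pi_div_two (by linarith) (by linarith) (by linarith)
  have h : Real.sin ε ≤ |Real.sin s.arg| := by
    rcases hs with ⟨-, h1, h2⟩ | ⟨-, h1, h2⟩
    · exact (key _ h1 h2).trans (le_abs_self _)
    · rw [← abs_neg, ← Real.sin_neg]
      exact (key _ h1 h2).trans (le_abs_self _)
  have h3 : s.im = ‖s‖ * Real.sin s.arg := (norm_mul_sin_arg s).symm
  simp only [imSector, mem_ofPred_eq]
  rw [h3, abs_mul, abs_norm, mul_comm]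
  gcongr

lemma log_add_ofReal {w : ℂ} (hw : w.im ≠ 0 ∨ 0 < w.re) {x : ℝ} (hx : 0 ≤ x) :
    log (w + x) = log w + log (1 + x / w) := by
  have hmem (y : ℝ) (hy : 0 ≤ y) : w + y ∈ slitPlane := by
    rw [mem_slitPlane_iff]
    rcases hw with h | h
    · right; simpa using h
    · left; simp; linarith
  have hws : w ∈ slitPlane := by simpa using hmem 0 le_rfl
  have hw0 : w ≠ 0 := slitPlane_ne_zero hws
  have h1 : 1 + x / w ≠ 0 := by
    have : 1 + x / w = (w + x) / w := by field_simp
    rw [this]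
    exact div_ne_zero (slitPlane_ne_zero (hmem x hx)) hw0
  have him : (1 + x / w).im = -(x * w.im / normSq w) := by
    simp [div_im]
  have hn : 0 < normSq w := normSq_pos.2 hw0
  rw [← (log_mul_eq_add_log_iff hw0 h1).2]
  · congr 1; field_simp
  have a1 := arg_mem_Ioc w
  have a2 := arg_mem_Ioc (1 + x / w)
  rcases lt_trichotomy w.im 0 with h | h | h
  · have : 0 ≤ (1 + x / w).im := by
      rw [him, neg_nonneg]
      exact div_nonpos_of_nonpos_of_nonneg (mul_nonpos_of_nonneg_of_nonpos hx h.le) hn.le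
    have b1 := arg_nonneg_iff.2 this
    have b2 := arg_neg_iff.2 h
    constructor <;> linarith [a1.1, a2.2]
  · have hre : 0 < w.re := hw.resolve_left (by simp [h])
    have e : w = (w.re : ℂ) := by apply Complex.ext <;> simp [h]
    have b1 : arg w = 0 := by rw [e]; exact arg_ofReal_of_nonneg hre.le
    rw [b1, zero_add]; exact a2
  · have : (1 + x / w).im ≤ 0 := by
      rw [him, neg_nonpos]; positivity
    have b1 : arg (1 + x / w) ≤ 0 := by
      rcases this.lt_or_eq with h' | h'
      · exact (arg_neg_iff.2 h').le
      · have hx0 : x = 0 := by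
          rw [him, neg_eq_zero, div_eq_zero_iff, mul_eq_zero] at h'
          exact (h'.resolve_right hn.ne').resolve_right h.ne'
        simp [hx0]
    have b2 := arg_nonneg_iff.2 h.le
    constructor <;> linarith [a2.1, a1.2]

/-- The mixed second difference of the logarithm with steps `1` and `τ`. -/
def logDiff (τ : ℝ) (w : ℂ) : ℂ := log (w + (1 + τ : ℝ)) - log (w + (1 : ℝ)) - log (w + τ) + log w

lemma norm_logDiff_add_le {τ : ℝ} (hτ : 0 < τ) {w : ℂ} (hw : w.im ≠ 0 ∨ 0 < w.re)
    (hw2 : 2 * (1 + τ) ≤ ‖w‖) :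
    ‖1 / w ^ 2 + logDiff τ w / τ‖ ≤ 3 * (1 + τ) ^ 3 / τ / ‖w‖ ^ 3 := by
  have hn : 0 < ‖w‖ := by linarith
  have hw0 : w ≠ 0 := norm_pos_iff.1 hn
  have hτ0 : (τ : ℂ) ≠ 0 := by exact_mod_cast hτ.ne'
  have hb (x : ℝ) (hx : 0 ≤ x) (hx2 : x ≤ 1 + τ) :
      ‖logRem (x / w)‖ ≤ (1 + τ) ^ 3 / ‖w‖ ^ 3 := by
    have h0 : ‖(x : ℂ) / w‖ ≤ (1 + τ) / ‖w‖ := by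
      rw [norm_div, norm_real, Real.norm_of_nonneg hx]; gcongr
    have h1 : (1 + τ) / ‖w‖ ≤ 1 / 2 := by rw [div_le_iff₀ hn]; linarith
    refine (norm_logRem_le (h0.trans h1)).trans ?_
    rw [← div_pow]; gcongr
  have key : 1 / w ^ 2 + logDiff τ w / τ =
      (logRem ((1 + τ : ℝ) / w) - logRem ((1 : ℝ) / w) - logRem (τ / w)) / τ := by
    unfold logDiff logRem
    rw [log_add_ofReal hw (by positivity), log_add_ofReal hw zero_le_one,
      log_add_ofReal hw hτ.le]
    push_cast
    field_simp
    ring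
  rw [key, norm_div, norm_real, Real.norm_of_nonneg hτ.le]
  have : ‖logRem ((1 + τ : ℝ) / w) - logRem ((1 : ℝ) / w) - logRem (τ / w)‖ ≤
      3 * (1 + τ) ^ 3 / ‖w‖ ^ 3 := by
    refine (norm_sub_le _ _).trans ((add_le_add_left (norm_sub_le _ _) _).trans ?_)
    have e1 := hb (1 + τ) (by positivity) le_rfl
    have e2 := hb 1 zero_le_one (by linarith)
    have e3 := hb τ hτ.le (by linarith)
    calc _ ≤ (1 + τ) ^ 3 / ‖w‖ ^ 3 + (1 + τ) ^ 3 / ‖w‖ ^ 3 + (1 + τ) ^ 3 / ‖w‖ ^ 3 := by gcongr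
      _ = _ := by ring
  calc _ ≤ 3 * (1 + τ) ^ 3 / ‖w‖ ^ 3 / τ := by gcongr
    _ = _ := by ring

lemma sum_logDiff (τ : ℝ) (s : ℂ) (N : ℕ) :
    ∑ k ∈ Finset.range N ×ˢ Finset.range N, logDiff τ (latticePoint τ k + s) =
      log (s + (N * (1 + τ) : ℝ)) - log (s + (N : ℝ)) - log (s + (N * τ : ℝ)) + log s := by
  rw [Finset.sum_product]
  set g : ℕ → ℕ → ℂ := fun i j => log (s + (i * τ + j : ℝ)) with hg
  have h (i j : ℕ) : logDiff τ (latticePoint τ (i, j) + s) =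
      (g (i + 1) (j + 1) - g i (j + 1)) - (g (i + 1) j - g i j) := by
    simp only [logDiff, latticePoint, hg]
    push_cast
    ring_nf
  simp only [h]
  have h2 (i : ℕ) := Finset.sum_range_sub (fun j => g (i + 1) j - g i j) N
  simp only [h2]
  have h3 : ∑ i ∈ Finset.range N, (g (i + 1) N - g i N - (g (i + 1) 0 - g i 0)) =
      ∑ i ∈ Finset.range N, ((g (i + 1) N - g (i + 1) 0) - (g i N - g i 0)) :=
    Finset.sum_congr rfl fun i _ => by ring
  rw [h3, Finset.sum_range_sub (fun i => g i N - g i 0)]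
  simp only [hg]
  push_cast
  ring_nf

lemma tendsto_log_add_sub_log {s : ℂ} :
    Tendsto (fun x : ℝ => log (s + x) - Real.log x) atTop (nhds 0) := by
  have h1 : Tendsto (fun x : ℝ => log (1 + s * (x⁻¹ : ℝ))) atTop (nhds (log (1 + s * (0 : ℝ)))) := by
    apply Tendsto.clog
    · exact ((continuous_ofReal.tendsto 0).comp tendsto_inv_atTop_zero).const_mul s |>.const_add 1
    · simp
  simp only [ofReal_zero, mul_zero, add_zero, log_one] at h1
  refine h1.congr' ?_
  filter_upwards [eventually_gt_atTop 0, eventually_gt_atTop ‖s‖] with x hx hxs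
  have hx0 : (x : ℂ) ≠ 0 := by exact_mod_cast hx.ne'
  have h2 : s + x = x * (1 + s * (x⁻¹ : ℝ)) := by push_cast; field_simp; ring
  rw [h2, log_ofReal_mul hx]
  · ring
  · intro h
    rw [h, mul_zero] at h2
    have : s = -x := by linear_combination h2
    rw [this, norm_neg, norm_real, Real.norm_of_nonneg hx.le] at hxs
    exact lt_irrefl _ hxs

lemma tsum_logDiff_sub {τ : ℝ} (hτ : 0 < τ) (s u : ℂ)
    (h : Summable fun k => logDiff τ (latticePoint τ k + s) - logDiff τ (latticePoint τ k + u)) :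
    ∑' k, (logDiff τ (latticePoint τ k + s) - logDiff τ (latticePoint τ k + u)) =
      log s - log u := by
  have hbox : Tendsto (fun N : ℕ => Finset.range N ×ˢ Finset.range N) atTop atTop := by
    apply tendsto_atTop_finset_of_monotone
    · intro a b hab
      exact Finset.product_subset_product (Finset.range_mono hab) (Finset.range_mono hab)
    · rintro ⟨i, j⟩
      refine ⟨max i j + 1, ?_⟩
      simp only [Finset.mem_product, Finset.mem_range]
      omega
  refine tendsto_nhds_unique (h.hasSum.comp hbox) ?_
  have hlin (c : ℝ) (hc : 0 < c) (z : ℂ) :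
      Tendsto (fun N : ℕ => log (z + (N * c : ℝ)) - Real.log (N * c)) atTop (nhds 0) :=
    tendsto_log_add_sub_log.comp
      (tendsto_natCast_atTop_atTop.atTop_mul_const hc)
  have h1 := (hlin (1 + τ) (by positivity) s).sub (hlin (1 + τ) (by positivity) u)
  have h2 := (hlin 1 (by positivity) s).sub (hlin 1 (by positivity) u)
  have h3 := (hlin τ hτ s).sub (hlin τ hτ u)
  have h4 := ((h1.sub h2).sub h3).add_const (log s - log u)
  simp only [sub_zero, zero_add] at h4
  refine h4.congr fun N => ?_
  simp only [Function.comp, Finset.sum_sub_distrib, sum_logDiff, mul_one]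
  ring

lemma inv_latticePoint_pow_le {τ : ℝ} (hτ : 0 < τ) {k : ℕ × ℕ} (hk : k ≠ (0, 0)) :
    (latticePoint τ k ^ 3)⁻¹ ≤ (1 / min τ 1 + 1) ^ 3 * ((1 + latticePoint τ k) ^ 3)⁻¹ := by
  have hω := latticePoint_pos hτ hk
  have hmin : 0 < min τ 1 := lt_min hτ one_pos
  have h : 1 + latticePoint τ k ≤ (1 / min τ 1 + 1) * latticePoint τ k := by
    have : 1 ≤ 1 / min τ 1 * latticePoint τ k := by
      rw [div_mul_eq_mul_div, one_mul, le_div_iff₀ hmin, one_mul]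
      exact min_le_latticePoint hτ hk
    linarith
  rw [← div_eq_mul_inv, le_div_iff₀ (by positivity), inv_mul_le_iff₀ (by positivity), ← mul_pow,
    mul_comm (latticePoint τ k)]
  gcongr

lemma summable_of_eventually_norm_le {τ : ℝ} (hτ : 0 < τ) {f : ℕ × ℕ → ℂ} {K : ℝ} (hK : 0 ≤ K)
    (h : ∀ᶠ k in cofinite, k ≠ (0, 0) → ‖f k‖ ≤ K * (latticePoint τ k ^ 3)⁻¹) : Summable f := by
  refine (((summable_latticePoint hτ).mul_left ((1 / min τ 1 + 1) ^ 3)).mul_left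
    K).of_norm_bounded_eventually ?_
  filter_upwards [h, (Set.finite_singleton ((0, 0) : ℕ × ℕ)).compl_mem_cofinite] with k hk hk0
  exact (hk hk0).trans (mul_le_mul_of_nonneg_left (inv_latticePoint_pow_le hτ hk0) hK)

lemma eventually_lt_latticePoint {τ : ℝ} (hτ : 0 < τ) {r : ℝ} (hr : 0 ≤ r) :
    ∀ᶠ k in cofinite, r < latticePoint τ k := by
  have h := (summable_latticePoint hτ).tendsto_cofinite_zero
  have h2 := h.eventually (gt_mem_nhds (show 0 < ((1 + r) ^ 3)⁻¹ by positivity))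
  filter_upwards [h2] with k hk
  have h0 := latticePoint_nonneg hτ k
  rw [inv_lt_inv₀ (by positivity) (by positivity)] at hk
  linarith [lt_of_pow_lt_pow_left₀ 3 (by positivity) hk]

lemma norm_inv_sq_sub_le {x A : ℝ} (hx : 0 < x) {s : ℂ} (h : x + ‖s‖ ≤ A * ‖(x : ℂ) + s‖) :
    ‖1 / (x : ℂ) ^ 2 - 1 / (x + s) ^ 2‖ ≤ 2 * ‖s‖ * A ^ 2 * (x ^ 3)⁻¹ := by
  have hpos : 0 < A * ‖(x : ℂ) + s‖ := by linarith [norm_nonneg s]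
  have hn : 0 < ‖(x : ℂ) + s‖ := by
    refine (norm_nonneg _).lt_of_ne fun h0 => ?_
    simp [← h0] at hpos
  have hA : 0 < A := pos_of_mul_pos_left hpos hn.le
  have hx0 : (x : ℂ) ≠ 0 := by exact_mod_cast hx.ne'
  have e : 1 / (x : ℂ) ^ 2 - 1 / (x + s) ^ 2 =
      s * (((x : ℂ) + s) + x) / (x ^ 2 * (x + s) ^ 2) := by
    have := norm_pos_iff.1 hn
    field_simp
    ring
  have h3 : ‖((x : ℂ) + s) + x‖ ≤ 2 * (A * ‖(x : ℂ) + s‖) := by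
    calc _ ≤ ‖(x : ℂ)‖ + ‖s‖ + ‖(x : ℂ)‖ := norm_add₃_le.trans' (by simp)
      _ = x + ‖s‖ + x := by simp [abs_of_pos hx]
      _ ≤ _ := by linarith [norm_nonneg s]
  have hxA : x ≤ A * ‖(x : ℂ) + s‖ := by linarith [norm_nonneg s]
  rw [e, norm_div, norm_mul, norm_mul, norm_pow, norm_pow, norm_real, Real.norm_of_nonneg hx.le,
    div_le_iff₀ (by positivity)]
  calc ‖s‖ * ‖((x : ℂ) + s) + x‖ ≤ ‖s‖ * (2 * (A * ‖(x : ℂ) + s‖)) := by gcongr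
    _ = 2 * ‖s‖ * A * ‖(x : ℂ) + s‖ * x * x⁻¹ := by field_simp
    _ ≤ 2 * ‖s‖ * A * ‖(x : ℂ) + s‖ * (A * ‖(x : ℂ) + s‖) * x⁻¹ := by gcongr
    _ = _ := by field_simp

lemma norm_inv_sub_add_le {x A : ℝ} (hx : 0 < x) {s : ℂ} (h : x + ‖s‖ ≤ A * ‖(x : ℂ) + s‖) :
    ‖1 / ((x : ℂ) + s) - 1 / x + s / (x : ℂ) ^ 2‖ ≤ ‖s‖ ^ 2 * A * (x ^ 3)⁻¹ := by
  have hpos : 0 < A * ‖(x : ℂ) + s‖ := by linarith [norm_nonneg s]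
  have hn : 0 < ‖(x : ℂ) + s‖ := by
    refine (norm_nonneg _).lt_of_ne fun h0 => ?_
    simp [← h0] at hpos
  have hx0 : (x : ℂ) ≠ 0 := by exact_mod_cast hx.ne'
  have e : 1 / ((x : ℂ) + s) - 1 / x + s / (x : ℂ) ^ 2 = s ^ 2 / (x ^ 2 * (x + s)) := by
    have := norm_pos_iff.1 hn
    field_simp
    ring
  have hxA : x ≤ A * ‖(x : ℂ) + s‖ := by linarith [norm_nonneg s]
  rw [e, norm_div, norm_mul, norm_pow, norm_pow, norm_real, Real.norm_of_nonneg hx.le,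
    div_le_iff₀ (by positivity)]
  calc ‖s‖ ^ 2 = ‖s‖ ^ 2 * x * x⁻¹ := by field_simp
    _ ≤ ‖s‖ ^ 2 * (A * ‖(x : ℂ) + s‖) * x⁻¹ := by gcongr
    _ = _ := by field_simp

/-- The summand `1/(ω+s) - 1/ω + s/ω²` of the first-order coefficient at the lattice point `ω`. -/
def linTerm (τ : ℝ) (s : ℂ) (k : ℕ × ℕ) : ℂ :=
  1 / ((latticePoint τ k : ℂ) + s) - 1 / latticePoint τ k + s / (latticePoint τ k : ℂ) ^ 2

/-- The summand `1/ω² - 1/(ω+s)²` of the second-order coefficient at the lattice point `ω`. -/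
def quadTerm (τ : ℝ) (s : ℂ) (k : ℕ × ℕ) : ℂ :=
  1 / (latticePoint τ k : ℂ) ^ 2 - 1 / ((latticePoint τ k : ℂ) + s) ^ 2

section

variable {τ κ : ℝ}

lemma summable_linTerm (hτ : 0 < τ) (hκ : 0 < κ) {s : ℂ} (hs : s ∈ imSector κ) :
    Summable (linTerm τ s) :=
  summable_of_eventually_norm_le hτ (by positivity) <| .of_forall fun k hk =>
    norm_inv_sub_add_le (latticePoint_pos hτ hk)
      (add_norm_le_of_mem_imSector hκ hs (latticePoint_nonneg hτ k))

lemma summable_quadTerm (hτ : 0 < τ) (hκ : 0 < κ) {s : ℂ} (hs : s ∈ imSector κ) :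
    Summable (quadTerm τ s) :=
  summable_of_eventually_norm_le hτ (by positivity) <| .of_forall fun k hk =>
    norm_inv_sq_sub_le (latticePoint_pos hτ hk)
      (add_norm_le_of_mem_imSector hκ hs (latticePoint_nonneg hτ k))

lemma summable_logRem_div (hτ : 0 < τ) (s : ℂ) :
    Summable fun k => logRem (s / latticePoint τ k) := by
  refine summable_of_eventually_norm_le hτ (K := ‖s‖ ^ 3) (by positivity) ?_
  filter_upwards [eventually_lt_latticePoint hτ (r := 2 * ‖s‖) (by positivity)] with k hk hk0
  have hω := latticePoint_pos hτ hk0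
  have e : ‖s / latticePoint τ k‖ = ‖s‖ / latticePoint τ k := by
    rw [norm_div, norm_real, Real.norm_of_nonneg hω.le]
  refine (norm_logRem_le ?_).trans_eq ?_
  · rw [e, div_le_iff₀ hω]; linarith
  · rw [e, div_pow, div_eq_mul_inv]

lemma norm_logRem_shift_le (hτ : 0 < τ) (hκ : 0 < κ) {s c : ℂ} (hs : s ∈ imSector κ)
    (h1 : 1 ≤ ‖s‖) (hc : 2 * (1 + 2 / κ) * ‖c‖ ≤ ‖s‖) (k : ℕ × ℕ) :
    ‖c / ((latticePoint τ k : ℂ) + s)‖ ≤ 1 / 2 ∧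
    ‖logRem (c / ((latticePoint τ k : ℂ) + s))‖ ≤
      (‖c‖ * (1 + 2 / κ)) ^ 3 * ((1 + latticePoint τ k) ^ 3)⁻¹ := by
  have h0 := latticePoint_nonneg hτ k
  have h := add_norm_le_of_mem_imSector hκ hs h0
  set w := (latticePoint τ k : ℂ) + s
  have hA : 0 < 1 + 2 / κ := by positivity
  have hw : 0 < ‖w‖ := pos_of_mul_pos_right (by linarith) hA.le
  have hhalf : ‖c / w‖ ≤ 1 / 2 := by
    rw [norm_div, div_le_iff₀ hw]
    have : (1 + 2 / κ) * (2 * ‖c‖) ≤ (1 + 2 / κ) * ‖w‖ := by linarith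
    linarith [le_of_mul_le_mul_left this hA]
  refine ⟨hhalf, (norm_logRem_le hhalf).trans ?_⟩
  rw [norm_div, ← div_eq_mul_inv, ← div_pow]
  gcongr ?_ ^ 3
  rw [div_le_div_iff₀ hw (by positivity)]
  calc ‖c‖ * (1 + latticePoint τ k) ≤ ‖c‖ * ((1 + 2 / κ) * ‖w‖) := by gcongr; linarith
    _ = _ := by ring

lemma im_ne_zero_of_mem_imSector (hκ : 0 < κ) {s : ℂ} (hs : s ∈ imSector κ) (h : 0 < ‖s‖) :
    s.im ≠ 0 :=
  abs_pos.1 ((mul_pos hκ h).trans_le hs)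

/-- The second-order coefficient grows like `log |s| / τ`. -/
lemma exists_norm_tsum_quadTerm_sub_le (hτ : 0 < τ) (hκ : 0 < κ) :
    ∃ R C : ℝ, ∀ s ∈ imSector κ, R ≤ ‖s‖ →
      ‖∑' k, quadTerm τ s k - Real.log ‖s‖ / τ‖ ≤ C := by
  set A := 1 + 2 / κ with hA
  have hApos : 0 < A := by positivity
  set u := 2 * (1 + τ) with hu
  have hupos : 0 < u := by positivity
  set V : ℕ × ℕ → ℝ := fun k => ((1 + latticePoint τ k) ^ 3)⁻¹ with hV
  have hVs : Summable V := summable_latticePoint hτ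
  set D := 3 * (1 + τ) ^ 3 / τ with hD
  set K := 1 + 2 * u * (1 / min τ 1 + 1) ^ 3 + D + D * A ^ 3 with hK
  have hmin : 0 < min τ 1 := lt_min hτ one_pos
  refine ⟨A * u + 1, K * ∑' k, V k + (‖log (u : ℂ)‖ + Real.pi) / τ, fun s hs hR => ?_⟩
  have hs1 : 1 ≤ ‖s‖ := by nlinarith [mul_pos hApos hupos]
  have hd (k : ℕ × ℕ) : latticePoint τ k + ‖s‖ ≤ A * ‖(latticePoint τ k : ℂ) + s‖ :=
    add_norm_le_of_mem_imSector hκ hs (latticePoint_nonneg hτ k)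
  have him := im_ne_zero_of_mem_imSector hκ hs (by linarith)
  set e : ℕ × ℕ → ℂ := fun k =>
    quadTerm τ s k - (logDiff τ (latticePoint τ k + s) - logDiff τ (latticePoint τ k + u)) / τ
    with he
  have hu1 (k : ℕ × ℕ) : ‖(latticePoint τ k : ℂ) + u‖ = latticePoint τ k + u := by
    rw [← ofReal_add, norm_real, Real.norm_of_nonneg]
    linarith [latticePoint_nonneg hτ k]
  have b1 (k : ℕ × ℕ) : ‖quadTerm τ u k‖ ≤ (1 + 2 * u * (1 / min τ 1 + 1) ^ 3) * V k := by
    have hV0 : 0 ≤ V k := by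
      have := latticePoint_nonneg hτ k
      simp only [hV]; positivity
    by_cases hk : k = (0, 0)
    · subst hk
      have : ‖quadTerm τ u (0, 0)‖ = (u ^ 2)⁻¹ := by
        simp [quadTerm, latticePoint, abs_of_pos hupos]
      have hVk : V (0, 0) = 1 := by simp [hV, latticePoint]
      rw [this, hVk, mul_one]
      have : (u ^ 2)⁻¹ ≤ 1 := inv_le_one_of_one_le₀ (by nlinarith)
      have : 0 ≤ 2 * u * (1 / min τ 1 + 1) ^ 3 := by positivity
      linarith
    · have hω := latticePoint_pos hτ hk
      have := norm_inv_sq_sub_le (A := 1) hω (s := (u : ℂ))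
        (by rw [hu1, norm_real, Real.norm_of_nonneg hupos.le, one_mul])
      rw [norm_real, Real.norm_of_nonneg hupos.le, one_pow, mul_one] at this
      calc _ ≤ 2 * u * (latticePoint τ k ^ 3)⁻¹ := this
        _ ≤ 2 * u * ((1 / min τ 1 + 1) ^ 3 * V k) := by
          gcongr
          exact inv_latticePoint_pow_le hτ hk
        _ ≤ _ := by linarith
  have b2 (k : ℕ × ℕ) : ‖1 / ((latticePoint τ k : ℂ) + u) ^ 2 +
      logDiff τ (latticePoint τ k + u) / τ‖ ≤ D * V k := by
    have h0 := latticePoint_nonneg hτ k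
    refine (norm_logDiff_add_le hτ (Or.inr (by simp; linarith)) (by rw [hu1]; linarith)).trans ?_
    rw [hu1, div_eq_mul_inv]
    simp only [hV]
    gcongr (?_ * (?_ ^ 3)⁻¹)
    linarith
  have b3 (k : ℕ × ℕ) : ‖1 / ((latticePoint τ k : ℂ) + s) ^ 2 +
      logDiff τ (latticePoint τ k + s) / τ‖ ≤ D * A ^ 3 * V k := by
    have h0 := latticePoint_nonneg hτ k
    have hk := hd k
    have hu2 : u ≤ ‖(latticePoint τ k : ℂ) + s‖ :=
      le_of_mul_le_mul_left (by linarith) hApos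
    refine (norm_logDiff_add_le hτ (Or.inl (by simpa using him)) hu2).trans ?_
    rw [← hD, div_eq_mul_inv, mul_assoc]
    gcongr
    have hn : 0 < ‖(latticePoint τ k : ℂ) + s‖ := by linarith
    simp only [hV]
    rw [← div_eq_mul_inv, le_div_iff₀ (by positivity), inv_mul_le_iff₀ (by positivity), ← mul_pow,
      mul_comm _ A]
    gcongr
    linarith
  have hbound (k : ℕ × ℕ) : ‖e k‖ ≤ K * V k := by
    have : e k = quadTerm τ u k + (1 / ((latticePoint τ k : ℂ) + u) ^ 2 +
      logDiff τ (latticePoint τ k + u) / τ) - (1 / ((latticePoint τ k : ℂ) + s) ^ 2 +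
      logDiff τ (latticePoint τ k + s) / τ) := by
      simp only [he, quadTerm]; ring
    rw [this]
    refine (norm_sub_le _ _).trans ((add_le_add (norm_add_le _ _) le_rfl).trans ?_)
    refine (add_le_add (add_le_add (b1 k) (b2 k)) (b3 k)).trans_eq ?_
    rw [hK]; ring
  have hes : Summable e := (hVs.mul_left K).of_norm_bounded hbound
  have hq := summable_quadTerm hτ hκ hs
  have hτ0 : (τ : ℂ) ≠ 0 := by exact_mod_cast hτ.ne'
  have hl : Summable fun k =>
      logDiff τ (latticePoint τ k + s) - logDiff τ (latticePoint τ k + u) := by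
    refine ((hq.sub hes).mul_right (τ : ℂ)).congr fun k => ?_
    simp only [he]; field_simp; ring
  have htsum : ∑' k, quadTerm τ s k = ∑' k, e k + (log s - log u) / τ := by
    rw [← tsum_logDiff_sub hτ s u hl, ← tsum_div_const, ← hes.tsum_add (hl.div_const _)]
    exact tsum_congr fun k => by simp only [he]; ring
  have hlog : log s - Real.log ‖s‖ = s.arg * I := by simp [log]
  have heq : ∑' k, quadTerm τ s k - Real.log ‖s‖ / τ = ∑' k, e k + (s.arg * I - log u) / τ := by
    rw [htsum, ← hlog]; ring
  rw [heq]
  refine (norm_add_le _ _).trans (add_le_add ?_ ?_)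
  · rw [← tsum_mul_left]
    exact tsum_of_norm_bounded (hVs.mul_left K).hasSum hbound
  · rw [norm_div, norm_real, Real.norm_of_nonneg hτ.le]
    gcongr
    refine (norm_sub_le _ _).trans ?_
    have : ‖(s.arg : ℂ) * I‖ ≤ Real.pi := by simpa using abs_arg_le_pi s
    linarith

lemma exp_logRem {u : ℂ} (hu : 1 + u ≠ 0) : exp (logRem u) = (1 + u) * exp (-u + u ^ 2 / 2) := by
  rw [logRem, show log (1 + u) - u + u ^ 2 / 2 = log (1 + u) + (-u + u ^ 2 / 2) by ring, exp_add,
    exp_log hu]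

/-- Expansion of the Barnes double gamma function around a large point `s` of a sector. -/
lemma exists_barnesG_add_eq_exp (hτ : 0 < τ) (hκ : 0 < κ) :
    ∃ g₀ g₁ : ℂ → ℂ, ∀ c : ℂ, ∃ R C : ℝ, ∀ s ∈ imSector κ, R ≤ ‖s‖ → ∃ e : ℂ, ‖e‖ ≤ C ∧
      barnesG (s + c) τ =
        exp (g₀ s + c * g₁ s + c ^ 2 * (Real.log ‖s‖ / (2 * τ)) + e) := by
  obtain ⟨R, C, hRC⟩ := exists_norm_tsum_quadTerm_sub_le hτ hκ
  have hτ0 : (τ : ℂ) ≠ 0 := by exact_mod_cast hτ.ne'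
  refine ⟨fun s => log (s / τ) + aBarnes τ * s / τ + bBarnes τ * s ^ 2 / (2 * τ) +
      ∑' k, logRem (s / latticePoint τ k),
    fun s => aBarnes τ / τ + bBarnes τ * s / τ + ∑' k, linTerm τ s k, fun c => ?_⟩
  set V : ℕ × ℕ → ℝ := fun k => (‖c‖ * (1 + 2 / κ)) ^ 3 * ((1 + latticePoint τ k) ^ 3)⁻¹
  have hV : Summable V := (summable_latticePoint hτ).mul_left _
  refine ⟨max R (max 1 (2 * (1 + 2 / κ) * ‖c‖)),
    ‖c ^ 2 * bBarnes τ / (2 * τ)‖ + ‖c ^ 2 / 2‖ * C + ∑' k, V k, fun s hs hsR => ?_⟩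
  simp only [max_le_iff] at hsR
  obtain ⟨hR, h1, hc⟩ := hsR
  have hrem := norm_logRem_shift_le hτ hκ hs h1 hc
  have him := im_ne_zero_of_mem_imSector hκ hs (by linarith)
  have hs0 : s ≠ 0 := fun h => him (by simp [h])
  have hr : Summable fun k => logRem (c / ((latticePoint τ k : ℂ) + s)) :=
    hV.of_norm_bounded fun k => (hrem k).2
  refine ⟨c ^ 2 * bBarnes τ / (2 * τ) + c ^ 2 / 2 * (∑' k, quadTerm τ s k - Real.log ‖s‖ / τ) +
    ∑' k, logRem (c / ((latticePoint τ k : ℂ) + s)), ?_, ?_⟩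
  · refine norm_add₃_le.trans (add_le_add (add_le_add le_rfl ?_) ?_)
    · rw [norm_mul]
      gcongr
      exact hRC s hs hR
    · exact tsum_of_norm_bounded hV.hasSum fun k => (hrem k).2
  set T : ℕ × ℕ → ℂ := fun k => logRem (s / latticePoint τ k) + c * linTerm τ s k +
    c ^ 2 / 2 * quadTerm τ s k + logRem (c / ((latticePoint τ k : ℂ) + s)) with hT
  have hTsum : HasSum T (∑' k, logRem (s / latticePoint τ k) + c * ∑' k, linTerm τ s k +
      c ^ 2 / 2 * ∑' k, quadTerm τ s k + ∑' k, logRem (c / ((latticePoint τ k : ℂ) + s))) :=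
    (((summable_logRem_div hτ s).hasSum.add ((summable_linTerm hτ hκ hs).hasSum.mul_left c)).add
      ((summable_quadTerm hτ hκ hs).hasSum.mul_left _)).add hr.hasSum
  have hne (k : ℕ × ℕ) : 1 + c / ((latticePoint τ k : ℂ) + s) ≠ 0 := fun h => by
    have h2 := (hrem k).1
    rw [show c / ((latticePoint τ k : ℂ) + s) = -1 by linear_combination h] at h2
    norm_num at h2
  have hws (k : ℕ × ℕ) : (latticePoint τ k : ℂ) + s ≠ 0 := fun h => him <| by
    simpa using congrArg Complex.im h
  have hT0 : exp (T (0, 0)) = 1 + c / s := by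
    have h0 := hne (0, 0)
    have hz : latticePoint τ (0, 0) = 0 := by simp [latticePoint]
    rw [← exp_log (x := 1 + c / s) (by simpa [hz] using h0)]
    congr 1
    simp only [hT, linTerm, quadTerm, logRem, hz]
    simp
    field_simp
    ring
  have hterm (k : ℕ × ℕ) (hk : k ≠ (0, 0)) : exp (T k) = (1 + (s + c) / (k.1 * τ + k.2)) *
      exp (-((s + c) / (k.1 * τ + k.2)) +
        (s + c) ^ 2 / (2 * ((k.1 : ℂ) * τ + (k.2 : ℂ)) ^ 2)) := by
    have hcast : (k.1 : ℂ) * τ + k.2 = (latticePoint τ k : ℝ) := by simp [latticePoint]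
    have hωr := (latticePoint_pos hτ hk).ne'
    have hω : (latticePoint τ k : ℂ) ≠ 0 := by exact_mod_cast hωr
    have hw := hws k
    have h2 : 1 + s / (latticePoint τ k : ℂ) ≠ 0 := by
      rw [show 1 + s / (latticePoint τ k : ℂ) = ((latticePoint τ k : ℂ) + s) / latticePoint τ k by
        field_simp]
      exact div_ne_zero hw hω
    rw [hcast]
    simp only [hT, exp_add (_ + _) (logRem _), exp_logRem (hne k)]
    rw [add_assoc, exp_add, exp_logRem h2]
    have h3 : (1 + (s + c) / (latticePoint τ k : ℂ)) =
        (1 + s / latticePoint τ k) * (1 + c / ((latticePoint τ k : ℂ) + s)) := by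
      field_simp
      ring
    have h4 (x y A B D : ℂ) : x * exp A * exp B * (y * exp D) = x * y * exp (A + B + D) := by
      rw [exp_add, exp_add]; ring
    rw [h3, h4]
    congr 2
    simp only [linTerm, quadTerm]
    field_simp
    ring
  have hprod : (∏' mn : ℕ × ℕ, if mn = (0, 0) then (1 : ℂ)
      else (1 + (s + c) / (mn.1 * τ + mn.2)) * exp (-((s + c) / (mn.1 * τ + mn.2)) +
        (s + c) ^ 2 / (2 * ((mn.1 : ℂ) * τ + (mn.2 : ℂ)) ^ 2))) = exp (∑' k, T k - T (0, 0)) := by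
    have h := (hasSum_ite_sub_hasSum hTsum.summable.hasSum (0, 0)).cexp
    rw [← h.tprod_eq]
    refine tprod_congr fun k => ?_
    by_cases hk : k = (0, 0)
    · simp [hk]
    · simp [hk, hterm k hk]
  have hsτ : s / τ ≠ 0 := div_ne_zero hs0 hτ0
  rw [barnesG, hprod, hTsum.tsum_eq, exp_sub, hT0]
  have h1c : 1 + c / s ≠ 0 := by
    rw [← hT0]; exact exp_ne_zero _
  have hsc : s + c = s * (1 + c / s) := by field_simp
  have hfront : (s + c) / τ = exp (log (s / τ)) * (1 + c / s) := by
    rw [exp_log hsτ, hsc]; ring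
  rw [hfront]
  have h5 (x y z w : ℂ) (hy : y ≠ 0) : x * y * z * (w / y) = x * z * w := by field_simp
  rw [h5 _ _ _ _ h1c, ← exp_add, ← exp_add]
  congr 1
  field_simp
  ring

lemma exists_prod_barnesG_eq_exp {ι : Type*} [Fintype ι] {z : ℂ → ℂ} {S : Set ℂ} {g₀ g₁ l : ℂ → ℂ}
    (h : ∀ c : ℂ, ∃ R C : ℝ, ∀ s ∈ S, R ≤ ‖s‖ → ∃ e : ℂ, ‖e‖ ≤ C ∧
      barnesG (z s + c) τ = exp (g₀ s + c * g₁ s + c ^ 2 * l s + e))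
    (Q : ι → Prop) [DecidablePred Q] (c : ι → ℂ) :
    ∃ R C : ℝ, ∀ s ∈ S, R ≤ ‖s‖ → ∃ e : ℂ, ‖e‖ ≤ C ∧
      (∏ j, if Q j then barnesG (z s + c j) τ else 1) =
        exp ((∑ j, if Q j then (1 : ℂ) else 0) * g₀ s + (∑ j, if Q j then c j else 0) * g₁ s +
          (∑ j, if Q j then c j ^ 2 else 0) * l s + e) := by
  choose R C hRC using fun j => h (c j)
  refine ⟨∑ j, |R j|, ∑ j, |C j|, fun s hs hR => ?_⟩
  have hRj (j : ι) : R j ≤ ‖s‖ := (le_abs_self _).trans <|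
    (Finset.single_le_sum (fun i _ => abs_nonneg (R i)) (Finset.mem_univ j)).trans hR
  choose e he heq using fun j => hRC j s hs (hRj j)
  refine ⟨∑ j, if Q j then e j else 0, ?_, ?_⟩
  · refine norm_sum_le_of_le _ fun j _ => ?_
    split_ifs
    · exact (he j).trans (le_abs_self _)
    · simp
  · simp only [Finset.sum_mul, ← Finset.sum_add_distrib, exp_sum]
    refine Finset.prod_congr rfl fun j _ => ?_
    split_ifs
    · rw [heq j, one_mul]
    · simp

lemma sum_ite_lt_one {m p : ℕ} (h : m ≤ p) :
    (∑ j : Fin p, if (j : ℕ) < m then (1 : ℂ) else 0) = m := by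
  rw [Fin.sum_univ_eq_sum_range (fun j => if j < m then (1 : ℂ) else 0), ← Finset.sum_filter]
  have : (Finset.range p).filter (· < m) = Finset.range m := by
    ext j; simp; omega
  simp [this]

lemma sum_ite_lt_add_sum_ite_le {p : ℕ} (m : ℕ) (f : Fin p → ℂ) :
    (∑ j : Fin p, if (j : ℕ) < m then f j else 0) + (∑ j : Fin p, if m ≤ (j : ℕ) then f j else 0) =
      ∑ j, f j := by
  rw [← Finset.sum_add_distrib]
  refine Finset.sum_congr rfl fun j _ => ?_
  by_cases h : (j : ℕ) < m
  · simp [h]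
  · simp [h, not_lt.1 h]

lemma sum_ite_const_sub {ι : Type*} [Fintype ι] (Q : ι → Prop) [DecidablePred Q] (x : ℂ)
    (f : ι → ℂ) : (∑ j, if Q j then x - f j else 0) =
      x * (∑ j, if Q j then (1 : ℂ) else 0) - ∑ j, if Q j then f j else 0 := by
  rw [Finset.mul_sum, ← Finset.sum_sub_distrib]
  exact Finset.sum_congr rfl fun j _ => by split_ifs <;> simp

lemma sum_ite_const_sub_sq {ι : Type*} [Fintype ι] (Q : ι → Prop) [DecidablePred Q] (x : ℂ)
    (f : ι → ℂ) : (∑ j, if Q j then (x - f j) ^ 2 else 0) =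
      x ^ 2 * (∑ j, if Q j then (1 : ℂ) else 0) - 2 * x * (∑ j, if Q j then f j else 0) +
        ∑ j, if Q j then f j ^ 2 else 0 := by
  rw [Finset.mul_sum, Finset.mul_sum, ← Finset.sum_sub_distrib, ← Finset.sum_add_distrib]
  exact Finset.sum_congr rfl fun j _ => by split_ifs <;> ring

end

/-- Asymptotics of `𝒢^{m,n}_{p,q}(s)`, case `N = 0`, `p = q`, `μ = ν = 0`. -/
theorem calG_asymptotic_logarithmic (τ : ℝ) (hτ : 0 < τ) (ε : ℝ) (hε : ε ∈ Set.Ioo 0 Real.pi)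
    (m n : ℕ) {p : ℕ} (hm : m ≤ p) (hn : n ≤ p) (hN : paramN m n p p = 0)
    (a : Fin p → ℂ) (b : Fin p → ℂ)
    (hμ : paramMu m n a b = 0) (hν : paramNu a b = 0) :
    ∃ R C : ℝ, 0 < R ∧ 0 < C ∧
      ∀ s ∈ Splus ε ∪ Sminus ε, R ≤ ‖s‖ →
        calG m n a b s (τ : ℂ) ≠ 0 ∧
        ∃ E : ℂ, ‖E‖ ≤ C ∧
          calG m n a b s (τ : ℂ) =
            Complex.exp (paramXi m n a b / (2 * (τ : ℂ)) * (Real.log ‖s‖ : ℂ) + E) := by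
  set κ := Real.sin ε
  have hκ : 0 < κ := Real.sin_pos_of_pos_of_lt_pi hε.1 hε.2
  obtain ⟨g₀, g₁, hg⟩ := exists_barnesG_add_eq_exp hτ hκ
  have hgneg : ∀ c : ℂ, ∃ R C : ℝ, ∀ s ∈ imSector κ, R ≤ ‖s‖ → ∃ e : ℂ, ‖e‖ ≤ C ∧
      barnesG (-s + c) τ =
        exp (g₀ (-s) + c * g₁ (-s) + c ^ 2 * (Real.log ‖s‖ / (2 * τ)) + e) := fun c => by
    obtain ⟨R, C, h⟩ := hg c
    exact ⟨R, C, fun s hs hR => by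
      simpa using h (-s) (neg_mem_imSector hs) (by simpa using hR)⟩
  obtain ⟨R₁, C₁, h₁⟩ := exists_prod_barnesG_eq_exp (z := fun s => -s) (g₀ := fun s => g₀ (-s))
    (g₁ := fun s => g₁ (-s)) hgneg (fun j : Fin p => (j : ℕ) < m) b
  obtain ⟨R₂, C₂, h₂⟩ := exists_prod_barnesG_eq_exp (z := fun s => s) hg
    (fun j : Fin p => (j : ℕ) < n) (fun j => 1 + τ - a j)
  obtain ⟨R₃, C₃, h₃⟩ := exists_prod_barnesG_eq_exp (z := fun s => s) hg
    (fun j : Fin p => m ≤ (j : ℕ)) (fun j => 1 + τ - b j)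
  obtain ⟨R₄, C₄, h₄⟩ := exists_prod_barnesG_eq_exp (z := fun s => -s) (g₀ := fun s => g₀ (-s))
    (g₁ := fun s => g₁ (-s)) hgneg (fun j : Fin p => n ≤ (j : ℕ)) a
  refine ⟨|R₁| + |R₂| + |R₃| + |R₄| + 1, |C₁| + |C₂| + |C₃| + |C₄| + 1, by positivity,
    by positivity, fun s hs hR => ?_⟩
  have hsec : s ∈ imSector κ := mem_imSector_of_mem hε hs
  have p₁ := le_abs_self R₁
  have p₂ := le_abs_self R₂
  have p₃ := le_abs_self R₃
  have p₄ := le_abs_self R₄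
  have n₁ := abs_nonneg R₁
  have n₂ := abs_nonneg R₂
  have n₃ := abs_nonneg R₃
  have n₄ := abs_nonneg R₄
  obtain ⟨e₁, he₁, q₁⟩ := h₁ s hsec (by linarith)
  obtain ⟨e₂, he₂, q₂⟩ := h₂ s hsec (by linarith)
  obtain ⟨e₃, he₃, q₃⟩ := h₃ s hsec (by linarith)
  obtain ⟨e₄, he₄, q₄⟩ := h₄ s hsec (by linarith)
  have hcal : calG m n a b s τ =
      exp (paramXi m n a b / (2 * (τ : ℂ)) * (Real.log ‖s‖ : ℂ) + (e₁ + e₂ - e₃ - e₄)) := by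
    have hmn : (m : ℂ) + n = p := by
      have : (m : ℤ) + n = p := by unfold paramN at hN; omega
      exact_mod_cast this
    have cm := sum_ite_lt_one hm
    have cn := sum_ite_lt_one hn
    have cm' := sum_ite_lt_add_sum_ite_le m (fun _ : Fin p => (1 : ℂ))
    have cn' := sum_ite_lt_add_sum_ite_le n (fun _ : Fin p => (1 : ℂ))
    have sa := sum_ite_lt_add_sum_ite_le n a
    have sb := sum_ite_lt_add_sum_ite_le m b
    simp only [Finset.sum_const, Finset.card_univ, Fintype.card_fin, nsmul_eq_mul, mul_one]
      at cm' cn'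
    simp only [neg_add_eq_sub, add_comm s] at q₁ q₂ q₃ q₄
    unfold calG
    rw [q₁, q₂, q₃, q₄, ← exp_add, ← exp_add, ← exp_sub]
    congr 1
    simp only [sum_ite_const_sub, sum_ite_const_sub_sq]
    unfold paramNu at hν
    unfold paramMu at hμ
    unfold paramXi
    rw [← sa, ← sb] at hν
    rw [cm] at cm' ⊢
    rw [cn] at cn' ⊢
    generalize (∑ j : Fin p, if m ≤ (j : ℕ) then (1 : ℂ) else 0) = m' at *
    generalize (∑ j : Fin p, if n ≤ (j : ℕ) then (1 : ℂ) else 0) = n' at *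
    generalize (∑ j : Fin p, if (j : ℕ) < n then a j else 0) = A₁ at *
    generalize (∑ j : Fin p, if n ≤ (j : ℕ) then a j else 0) = A₂ at *
    generalize (∑ j : Fin p, if (j : ℕ) < m then b j else 0) = B₁ at *
    generalize (∑ j : Fin p, if m ≤ (j : ℕ) then b j else 0) = B₂ at *
    obtain rfl : m' = n := by linear_combination cm' - hmn
    obtain rfl : n' = m := by linear_combination cn' - hmn
    obtain rfl : A₁ = B₂ := by linear_combination (hμ + hν) / 2
    obtain rfl : A₂ = B₁ := by linear_combination (hν - hμ) / 2
    ring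
  rw [hcal]
  refine ⟨exp_ne_zero _, _, ?_, rfl⟩
  calc ‖e₁ + e₂ - e₃ - e₄‖ ≤ ‖e₁‖ + ‖e₂‖ + ‖e₃‖ + ‖e₄‖ :=
        (norm_sub_le _ _).trans (add_le_add ((norm_sub_le _ _).trans
          (add_le_add (norm_add_le _ _) le_rfl)) le_rfl)
    _ ≤ _ := by
      linarith [le_abs_self C₁, le_abs_self C₂, le_abs_self C₃, le_abs_self C₄]
end
end
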